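/- arXiv:1611.06258 — 8 statements merged into one kernel-verified Lean document; each statement's English description precedes it below -/
import Mathlib

section
/- Let H be a real rational function that is a minimum function with minimum frequency ω₀, and write H(jω₀) = jω₀X where X is real. If X > 0, then there exist real numbers μ > 0 and α > 0 and a positive-real rational function H_r whose McMillan degree is at most the McMillan degree of H minus 2, such that, as an identity of rational functions, H(s) = H(μ)·(s³ + H_r(s)(2α+μ)s² + ω₀²s + H_r(s)μω₀²) / (H_r(s)s³ + μs² + H_r(s)(2αμ+ω₀²)s + μω₀²). (Here H(μ) is a well-defined positive real number since a PR function has no poles with positive real part.) -/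
open Polynomial Matrix

/-- Evaluation of a real rational function at a complex point:
`p(λ)/q(λ)` for `H = p/q` in coprime (num/denom) form. -/
noncomputable def evalC (H : RatFunc ℝ) (z : ℂ) : ℂ :=
  H.num.eval₂ (algebraMap ℝ ℂ) z / H.denom.eval₂ (algebraMap ℝ ℂ) z

/-- Evaluation of a real rational function at a real point. -/
noncomputable def evalR (H : RatFunc ℝ) (x : ℝ) : ℝ :=
  H.num.eval x / H.denom.eval x

/-- `H` is positive-real: the denominator has no root with strictly positive real
part, and `Re (H λ) ≥ 0` whenever `Re λ > 0`. -/
def IsPR (H : RatFunc ℝ) : Prop :=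
  (∀ z : ℂ, 0 < z.re → H.denom.eval₂ (algebraMap ℝ ℂ) z ≠ 0) ∧
  (∀ z : ℂ, 0 < z.re → 0 ≤ (evalC H z).re)

/-- `H` has no poles or zeros on `jℝ ∪ ∞`: numerator and denominator have equal
degree and neither has a purely imaginary root. -/
def NoImagPolesZeros (H : RatFunc ℝ) : Prop :=
  H.num.natDegree = H.denom.natDegree ∧
  (∀ ω : ℝ, H.num.eval₂ (algebraMap ℝ ℂ) ((ω : ℂ) * Complex.I) ≠ 0) ∧
  (∀ ω : ℝ, H.denom.eval₂ (algebraMap ℝ ℂ) ((ω : ℂ) * Complex.I) ≠ 0)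

/-- `H` is a minimum function with minimum frequency `ω₀`. -/
def IsMinFun (H : RatFunc ℝ) (ω₀ : ℝ) : Prop :=
  IsPR H ∧ H ≠ 0 ∧ NoImagPolesZeros H ∧ 0 < ω₀ ∧
    (evalC H ((ω₀ : ℂ) * Complex.I)).re = 0

/-- The McMillan degree of a rational function. -/
noncomputable def McMillanDeg (H : RatFunc ℝ) : ℕ :=
  max H.num.natDegree H.denom.natDegree

/-- The biquadratic parametrisation of Lemma `bmfp`. -/
noncomputable def Hparam (K ω₀ W F : ℝ) : RatFunc ℝ :=
  RatFunc.C K *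
    (RatFunc.X ^ 2 + RatFunc.C (ω₀ * (1 - W) * F / W) * RatFunc.X +
        RatFunc.C (ω₀ ^ 2 * W)) /
    (RatFunc.X ^ 2 + RatFunc.C (ω₀ * (1 - W) / F) * RatFunc.X +
        RatFunc.C (ω₀ ^ 2 / W))

/-- Composition of a rational function with the map `s ↦ ω₀²/s`. -/
noncomputable def freqInv (ω₀ : ℝ) (H : RatFunc ℝ) : RatFunc ℝ :=
  RatFunc.eval (algebraMap ℝ (RatFunc ℝ)) (RatFunc.C (ω₀ ^ 2) / RatFunc.X) H

/-- The **Schwarz–Pick inequality** for maps from the right half-plane to the unit disc, at a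
point whose image is interior. -/
theorem norm_sub_mul_le_of_norm_le_one_of_lt {B : ℂ → ℂ}
    (hd : DifferentiableOn ℂ B {z | 0 < z.re}) (hB : ∀ z : ℂ, 0 < z.re → ‖B z‖ ≤ 1)
    {z w : ℂ} (hz : 0 < z.re) (hw : 0 < w.re) (hBw : ‖B w‖ < 1) :
    ‖B z - B w‖ * ‖z + star w‖ ≤ ‖z - w‖ * ‖1 - star (B w) * B z‖ := by
  have hne : ∀ x : ℂ, ‖x‖ ≤ 1 → 1 - star (B w) * x ≠ 0 := by
    intro x hx h
    have h1 : star (B w) * x = 1 := by linear_combination -h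
    have h2 : ‖B w‖ * ‖x‖ = 1 := by
      have := congrArg norm h1
      simpa using this
    nlinarith [norm_nonneg (B w), norm_nonneg x]
  have hle : ∀ x : ℂ, ‖x‖ ≤ 1 → ‖x - B w‖ ≤ ‖1 - star (B w) * x‖ := by
    intro x hx
    have h1 : ‖x‖ ^ 2 ≤ 1 := by nlinarith [norm_nonneg x]
    have h2 : ‖B w‖ ^ 2 ≤ 1 := by nlinarith [norm_nonneg (B w)]
    rw [← sq_le_sq₀ (norm_nonneg _) (norm_nonneg _)]
    rw [Complex.sq_norm, Complex.normSq_apply] at h1 h2 ⊢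
    rw [Complex.sq_norm, Complex.normSq_apply]
    simp only [Complex.sub_re, Complex.sub_im, Complex.mul_re, Complex.mul_im, Complex.one_re,
      Complex.one_im, Complex.star_def, Complex.conj_re, Complex.conj_im]
    nlinarith [mul_nonneg (sub_nonneg.2 h1) (sub_nonneg.2 h2)]
  have hden : ∀ ζ ∈ Metric.ball (0 : ℂ) 1, (1 : ℂ) - ζ ≠ 0 := by
    intro ζ hζ h
    have : ζ = 1 := by linear_combination -h
    simp [this] at hζ
  have hmaps : ∀ ζ ∈ Metric.ball (0 : ℂ) 1, 0 < ((w + star w * ζ) / (1 - ζ)).re := by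
    intro ζ hζ
    have h0 := hden ζ hζ
    have h1 : ‖ζ‖ ^ 2 < 1 := by
      have := mem_ball_zero_iff.1 hζ
      nlinarith [norm_nonneg ζ]
    rw [Complex.sq_norm, Complex.normSq_apply] at h1
    rw [Complex.div_re, ← add_div]
    apply div_pos _ (Complex.normSq_pos.2 h0)
    simp only [Complex.sub_re, Complex.sub_im, Complex.mul_re, Complex.mul_im, Complex.one_re,
      Complex.one_im, Complex.star_def, Complex.conj_re, Complex.conj_im, Complex.add_re,
      Complex.add_im]
    nlinarith [mul_pos hw (sub_pos.2 h1)]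
  have hzw : z + star w ≠ 0 := by
    intro h
    have := congrArg Complex.re h
    simp at this
    linarith
  have hζ : ‖(z - w) / (z + star w)‖ < 1 := by
    rw [norm_div, div_lt_one (norm_pos_iff.2 hzw), ← sq_lt_sq₀ (norm_nonneg _) (norm_nonneg _),
      Complex.sq_norm, Complex.sq_norm, Complex.normSq_apply, Complex.normSq_apply]
    simp only [Complex.sub_re, Complex.sub_im, Complex.star_def, Complex.conj_re,
      Complex.conj_im, Complex.add_re, Complex.add_im]
    nlinarith [mul_pos hz hw]
  have hw2 : w + star w ≠ 0 := by
    intro h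
    have := congrArg Complex.re h
    simp at this
    linarith
  have hinv : (w + star w * ((z - w) / (z + star w))) / (1 - (z - w) / (z + star w)) = z := by
    have : (1 - (z - w) / (z + star w)) = (w + star w) / (z + star w) := by
      field_simp
      ring
    rw [this]
    field_simp
    ring
  have key := Complex.norm_le_norm_of_mapsTo_ball (R := 1) (z := (z - w) / (z + star w))
    (f := fun ζ => (B ((w + star w * ζ) / (1 - ζ)) - B w) /
      (1 - star (B w) * B ((w + star w * ζ) / (1 - ζ)))) ?_ ?_ ?_ hζ
  · simp only [hinv] at key
    rw [norm_div, norm_div, div_le_div_iff₀ (norm_pos_iff.2 (hne _ (hB z hz)))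
      (norm_pos_iff.2 hzw)] at key
    exact key
  · have hcomp : DifferentiableOn ℂ (fun ζ => B ((w + star w * ζ) / (1 - ζ)))
        (Metric.ball 0 1) := by
      refine hd.comp (t := {z | 0 < z.re}) (f := fun ζ => (w + star w * ζ) / (1 - ζ)) ?_ hmaps
      exact DifferentiableOn.div (by fun_prop) (by fun_prop) hden
    exact DifferentiableOn.div (hcomp.sub_const _) ((hcomp.const_mul _).const_sub _)
      fun ζ h => hne _ (hB _ (hmaps ζ h))
  · intro ζ h
    have hb := hB _ (hmaps ζ h)
    rw [mem_closedBall_zero_iff, norm_div]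
    exact div_le_one_of_le₀ (hle _ hb) (norm_nonneg _)
  · simp

/-- The **Schwarz–Pick inequality** for maps from the right half-plane to the closed unit disc. -/
theorem norm_sub_mul_le_of_norm_le_one {B : ℂ → ℂ}
    (hd : DifferentiableOn ℂ B {z | 0 < z.re}) (hB : ∀ z : ℂ, 0 < z.re → ‖B z‖ ≤ 1)
    {z w : ℂ} (hz : 0 < z.re) (hw : 0 < w.re) :
    ‖B z - B w‖ * ‖z + star w‖ ≤ ‖z - w‖ * ‖1 - star (B w) * B z‖ := by
  have hlim : ∀ᶠ r : ℝ in nhdsWithin 1 (Set.Iio 1),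
      ‖(r : ℂ) * B z - r * B w‖ * ‖z + star w‖ ≤
        ‖z - w‖ * ‖1 - star ((r : ℂ) * B w) * (r * B z)‖ := by
    have hpos : ∀ᶠ r : ℝ in nhdsWithin 1 (Set.Iio 1), 0 < r :=
      mem_nhdsWithin_of_mem_nhds (lt_mem_nhds one_pos)
    filter_upwards [hpos, self_mem_nhdsWithin] with r hr0 hr1
    have hr1 : r < 1 := hr1
    have hlt : ∀ x : ℂ, 0 < x.re → ‖(r : ℂ) * B x‖ < 1 := by
      intro x hx
      rw [norm_mul, Complex.norm_real, Real.norm_of_nonneg hr0.le]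
      nlinarith [hB x hx, norm_nonneg (B x)]
    exact norm_sub_mul_le_of_norm_le_one_of_lt (B := fun x => (r : ℂ) * B x)
      (hd.const_mul _) (fun x hx => (hlt x hx).le) hz hw (hlt w hw)
  have h1 : Filter.Tendsto (fun r : ℝ => ‖(r : ℂ) * B z - r * B w‖ * ‖z + star w‖)
      (nhdsWithin 1 (Set.Iio 1)) (nhds (‖B z - B w‖ * ‖z + star w‖)) := by
    have : Continuous fun r : ℝ => ‖(r : ℂ) * B z - r * B w‖ * ‖z + star w‖ := by fun_prop
    simpa using (this.tendsto 1).mono_left nhdsWithin_le_nhds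
  have h2 : Filter.Tendsto (fun r : ℝ => ‖z - w‖ * ‖1 - star ((r : ℂ) * B w) * (r * B z)‖)
      (nhdsWithin 1 (Set.Iio 1)) (nhds (‖z - w‖ * ‖1 - star (B w) * B z‖)) := by
    have : Continuous fun r : ℝ => ‖z - w‖ * ‖1 - star ((r : ℂ) * B w) * (r * B z)‖ := by
      fun_prop
    simpa using (this.tendsto 1).mono_left nhdsWithin_le_nhds
  exact le_of_tendsto_of_tendsto h1 h2 hlim

/-- The two-point **Pick inequality** for a quotient `f / g` with nonnegative real part on the
right half-plane, in a homogeneous form that does not require `g` to be nonvanishing. -/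
theorem pick_inequality {f g : ℂ → ℂ} (hf : Differentiable ℂ f) (hg : Differentiable ℂ g)
    (hfg : ∀ z : ℂ, 0 < z.re → f z + g z ≠ 0)
    (hre : ∀ z : ℂ, 0 < z.re → 0 ≤ (f z * star (g z)).re)
    {z w : ℂ} (hz : 0 < z.re) (hw : 0 < w.re) :
    Complex.normSq (f z * g w - f w * g z) * (z.re * w.re) ≤
      Complex.normSq (z - w) * ((f z * star (g z)).re * (f w * star (g w)).re) := by
  have hd : DifferentiableOn ℂ (fun x => (f x - g x) / (f x + g x)) {z | 0 < z.re} :=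
    DifferentiableOn.div (by fun_prop) (by fun_prop) hfg
  have hB : ∀ x : ℂ, 0 < x.re → ‖(f x - g x) / (f x + g x)‖ ≤ 1 := by
    intro x hx
    rw [norm_div]
    apply div_le_one_of_le₀ _ (norm_nonneg _)
    have := hre x hx
    rw [← sq_le_sq₀ (norm_nonneg _) (norm_nonneg _), Complex.sq_norm, Complex.sq_norm,
      Complex.normSq_apply, Complex.normSq_apply]
    simp only [Complex.sub_re, Complex.sub_im, Complex.star_def, Complex.conj_re,
      Complex.conj_im, Complex.add_re, Complex.add_im, Complex.mul_re] at this ⊢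
    nlinarith
  have key := norm_sub_mul_le_of_norm_le_one hd hB hz hw
  have hz0 := hfg z hz
  have hw0 := hfg w hw
  have hw0' : star (f w + g w) ≠ 0 := star_ne_zero.2 hw0
  have e1 : (f z - g z) / (f z + g z) - (f w - g w) / (f w + g w) =
      2 * (f z * g w - f w * g z) / ((f z + g z) * (f w + g w)) := by
    field_simp
    ring
  have e2 : 1 - star ((f w - g w) / (f w + g w)) * ((f z - g z) / (f z + g z)) =
      2 * (f z * star (g w) + star (f w) * g z) / ((f z + g z) * star (f w + g w)) := by
    rw [star_div₀]
    field_simp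
    simp only [star_add, star_sub]
    ring
  have hpos : 0 < ‖f z + g z‖ * ‖f w + g w‖ :=
    mul_pos (norm_pos_iff.2 hz0) (norm_pos_iff.2 hw0)
  rw [e1, e2, norm_div, norm_div, norm_mul (f z + g z), norm_mul (f z + g z), norm_star,
    div_mul_eq_mul_div, mul_div_assoc', div_le_div_iff_of_pos_right hpos, norm_mul 2, norm_mul 2,
    Complex.norm_ofNat] at key
  have key2 := mul_self_le_mul_self (by positivity) key
  have key3 : Complex.normSq (f z * g w - f w * g z) * Complex.normSq (z + star w) ≤
      Complex.normSq (z - w) * Complex.normSq (f z * star (g w) + star (f w) * g z) := by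
    simp only [← Complex.sq_norm]
    linarith
  have e3 : Complex.normSq (z + star w) = Complex.normSq (z - w) + 4 * (z.re * w.re) := by
    simp only [Complex.normSq_apply, Complex.sub_re, Complex.sub_im, Complex.star_def,
      Complex.conj_re, Complex.conj_im, Complex.add_re, Complex.add_im]
    ring
  have e4 : Complex.normSq (f z * star (g w) + star (f w) * g z) =
      Complex.normSq (f z * g w - f w * g z) +
        4 * ((f z * star (g z)).re * (f w * star (g w)).re) := by
    simp only [Complex.normSq_apply, Complex.sub_re, Complex.sub_im, Complex.star_def,
      Complex.conj_re, Complex.conj_im, Complex.add_re, Complex.add_im, Complex.mul_re,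
      Complex.mul_im]
    ring
  rw [e3, e4] at key3
  linarith

/-- If `f / g` has nonnegative real part on the right half-plane and `g` vanishes at one point
of it, then `g` vanishes identically there. -/
theorem eq_zero_of_re_mul_star_nonneg {f g : ℂ → ℂ} (hf : Differentiable ℂ f)
    (hg : Differentiable ℂ g) (hfg : ∀ z : ℂ, 0 < z.re → f z + g z ≠ 0)
    (hre : ∀ z : ℂ, 0 < z.re → 0 ≤ (f z * star (g z)).re)
    {z w : ℂ} (hz : 0 < z.re) (hw : 0 < w.re) (hgw : g w = 0) : g z = 0 := by
  have h := pick_inequality hf hg hfg hre hz hw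
  have hfw : f w ≠ 0 := by simpa [hgw] using hfg w hw
  simp only [hgw, mul_zero, star_zero, Complex.zero_re, zero_sub] at h
  have h0 : Complex.normSq (-(f w * g z)) = 0 :=
    le_antisymm (nonpos_of_mul_nonpos_left h (mul_pos hz hw)) (Complex.normSq_nonneg _)
  simpa [hfw] using h0

/-- A **Julia-type lemma** at a zero `z₀` on the imaginary axis of a quotient
`(z - z₀) f₁ / g` with nonnegative real part on the right half-plane: its derivative at `z₀` is
a positive real number, which bounds the growth of the quotient. -/
theorem exists_pos_deriv_at_boundary_zero {f₁ g : ℂ → ℂ} {z₀ : ℂ} (hf : Differentiable ℂ f₁)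
    (hg : Differentiable ℂ g) (hz₀ : z₀.re = 0) (hgz₀ : g z₀ ≠ 0)
    (hfg : ∀ z : ℂ, 0 < z.re → (z - z₀) * f₁ z + g z ≠ 0)
    (hre : ∀ z : ℂ, 0 < z.re → 0 ≤ ((z - z₀) * f₁ z * star (g z)).re)
    (hne : ∃ z : ℂ, 0 < z.re ∧ f₁ z ≠ 0) :
    ∃ β : ℝ, 0 < β ∧ f₁ z₀ = β * g z₀ ∧ ∀ z : ℂ, 0 < z.re →
      Complex.normSq ((z - z₀) * f₁ z) * z.re ≤
        β * Complex.normSq (z - z₀) * ((z - z₀) * f₁ z * star (g z)).re := by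
  obtain ⟨b, hb⟩ : ∃ b, f₁ z₀ = b * g z₀ := ⟨f₁ z₀ / g z₀, by field_simp⟩
  have hf' : Differentiable ℂ fun z => (z - z₀) * f₁ z := by fun_prop
  have hcf := hf.continuous
  have hcg := hg.continuous
  have hgpos : 0 < Complex.normSq (g z₀) := Complex.normSq_pos.2 hgz₀
  have hmain : ∀ z : ℂ, 0 < z.re → Complex.normSq ((z - z₀) * f₁ z) * z.re ≤
      b.re * Complex.normSq (z - z₀) * ((z - z₀) * f₁ z * star (g z)).re := by
    intro z hz
    have hev : ∀ᶠ t : ℝ in nhdsWithin 0 (Set.Ioi 0),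
        Complex.normSq ((z - z₀) * f₁ z * g (z₀ + t) - t * f₁ (z₀ + t) * g z) * z.re ≤
          Complex.normSq (z - (z₀ + t)) * (((z - z₀) * f₁ z * star (g z)).re *
            (f₁ (z₀ + t) * star (g (z₀ + t))).re) := by
      filter_upwards [self_mem_nhdsWithin] with t ht
      have ht : 0 < t := ht
      have hwre : (z₀ + t : ℂ).re = t := by simp [hz₀]
      have h := pick_inequality hf' hg hfg hre hz (w := z₀ + t) (by rwa [hwre])
      rw [hwre, add_sub_cancel_left, mul_assoc (t : ℂ) _ (star _), Complex.re_ofReal_mul] at h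
      refine le_of_mul_le_mul_right ?_ ht
      linarith
    have h1 : Continuous fun t : ℝ =>
        Complex.normSq ((z - z₀) * f₁ z * g (z₀ + t) - t * f₁ (z₀ + t) * g z) * z.re :=
      (Complex.continuous_normSq.comp (by fun_prop)).mul continuous_const
    have h2 : Continuous fun t : ℝ =>
        Complex.normSq (z - (z₀ + t)) * (((z - z₀) * f₁ z * star (g z)).re *
            (f₁ (z₀ + t) * star (g (z₀ + t))).re) :=
      (Complex.continuous_normSq.comp (by fun_prop)).mul
        (continuous_const.mul (Complex.continuous_re.comp (by fun_prop)))
    have h := le_of_tendsto_of_tendsto ((h1.tendsto 0).mono_left nhdsWithin_le_nhds)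
      ((h2.tendsto 0).mono_left nhdsWithin_le_nhds) hev
    have e : (b * g z₀ * star (g z₀)).re = b.re * Complex.normSq (g z₀) := by
      rw [mul_assoc, Complex.star_def, Complex.mul_conj, mul_comm, Complex.re_ofReal_mul, mul_comm]
    simp only [Complex.ofReal_zero, add_zero, zero_mul, sub_zero] at h
    rw [hb, e, Complex.normSq_mul _ (g z₀)] at h
    refine le_of_mul_le_mul_right ?_ hgpos
    linarith
  have hbpos : 0 < b.re := by
    by_contra hcon
    obtain ⟨z, hz, hfz⟩ := hne
    have h := hmain z hz
    have hzz : z - z₀ ≠ 0 := by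
      intro h0
      have := congrArg Complex.re h0
      simp [hz₀] at this
      exact hz.ne' this
    have h1 : 0 < Complex.normSq ((z - z₀) * f₁ z) * z.re :=
      mul_pos (Complex.normSq_pos.2 (mul_ne_zero hzz hfz)) hz
    have h2 := mul_nonneg (Complex.normSq_nonneg (z - z₀)) (hre z hz)
    nlinarith [not_lt.1 hcon]
  have hreal : b.im = 0 := by
    have hev : ∀ᶠ t : ℝ in nhdsWithin 0 (Set.Ioi 0),
        Complex.normSq (f₁ (z₀ + t)) ≤ b.re * (f₁ (z₀ + t) * star (g (z₀ + t))).re := by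
      filter_upwards [self_mem_nhdsWithin] with t ht
      have ht : 0 < t := ht
      have hwre : (z₀ + t : ℂ).re = t := by simp [hz₀]
      have h := hmain (z₀ + t) (by rwa [hwre])
      rw [hwre, add_sub_cancel_left, mul_assoc (t : ℂ) _ (star _), Complex.re_ofReal_mul,
        Complex.normSq_mul, Complex.normSq_ofReal] at h
      refine le_of_mul_le_mul_right ?_ (pow_pos ht 3)
      linarith
    have h1 : Continuous fun t : ℝ => Complex.normSq (f₁ (z₀ + t)) :=
      Complex.continuous_normSq.comp (by fun_prop)
    have h2 : Continuous fun t : ℝ => b.re * (f₁ (z₀ + t) * star (g (z₀ + t))).re :=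
      continuous_const.mul (Complex.continuous_re.comp (by fun_prop))
    have h := le_of_tendsto_of_tendsto ((h1.tendsto 0).mono_left nhdsWithin_le_nhds)
      ((h2.tendsto 0).mono_left nhdsWithin_le_nhds) hev
    have e : (b * g z₀ * star (g z₀)).re = b.re * Complex.normSq (g z₀) := by
      rw [mul_assoc, Complex.star_def, Complex.mul_conj, mul_comm, Complex.re_ofReal_mul, mul_comm]
    simp only [Complex.ofReal_zero, add_zero] at h
    rw [hb, e, Complex.normSq_mul, ← mul_assoc] at h
    have h' := le_of_mul_le_mul_right h hgpos
    rw [Complex.normSq_apply] at h'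
    nlinarith
  refine ⟨b.re, hbpos, ?_, hmain⟩
  rw [hb]
  congr 1
  exact Complex.ext (by simp) (by simp [hreal])

/-- A real polynomial vanishing on the right half-plane is zero. -/
theorem eq_zero_of_aeval_eq_zero_of_re_pos {P : ℝ[X]} (h : ∀ z : ℂ, 0 < z.re → aeval z P = 0) :
    P = 0 := by
  refine Polynomial.eq_zero_of_infinite_isRoot P ((Set.Ioi_infinite (0 : ℝ)).mono ?_)
  intro x hx
  have h1 := h x (by simpa using hx)
  rw [← Complex.coe_algebraMap, aeval_algebraMap_apply] at h1
  simpa using h1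

/-- A real polynomial with a nonzero purely imaginary root `ωi` is divisible by `X² + ω²`. -/
theorem exists_eq_X_sq_add_C_mul {P : ℝ[X]} {ω : ℝ} (hω : ω ≠ 0)
    (h : aeval ((ω : ℂ) * Complex.I) P = 0) : ∃ Q : ℝ[X], P = (X ^ 2 + C (ω ^ 2)) * Q := by
  have hm : (X ^ 2 + C (ω ^ 2) : ℝ[X]).Monic := monic_X_pow_add_C _ two_ne_zero
  have hdeg : (X ^ 2 + C (ω ^ 2) : ℝ[X]).natDegree = 2 := natDegree_X_pow_add_C
  have hlt := natDegree_modByMonic_lt P hm (by intro h1; rw [h1] at hdeg; simp at hdeg)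
  obtain ⟨a, b, hab⟩ := exists_eq_X_add_C_of_natDegree_le_one (p := P %ₘ (X ^ 2 + C (ω ^ 2)))
    (by omega)
  have hP := modByMonic_add_div P (X ^ 2 + C (ω ^ 2))
  have hroot : aeval ((ω : ℂ) * Complex.I) (X ^ 2 + C (ω ^ 2) : ℝ[X]) = 0 := by
    simp [mul_pow]
  rw [← hP, map_add, map_mul, hroot, zero_mul, add_zero, hab] at h
  have hb : b = 0 := by simpa using congrArg Complex.re h
  have ha : a = 0 := by simpa [hω] using congrArg Complex.im h
  refine ⟨P /ₘ (X ^ 2 + C (ω ^ 2)), hP.symm.trans ?_⟩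
  rw [hab, ha, hb]
  simp

/-- The infinitesimal step of pole removal: a Julia-type bound on `u * Y / D` gives
nonnegativity of the real part of `u * Y / (D - β⁻¹ * Y)`. -/
theorem re_mul_star_sub_nonneg {u Y D : ℂ} {β x : ℝ} (hβ : 0 < β) (hux : u.re = x) (hx : 0 < x)
    (h : Complex.normSq (u * Y) * x ≤ β * Complex.normSq u * (u * Y * star D).re) :
    0 ≤ (u * Y * star (D - (β : ℂ)⁻¹ * Y)).re := by
  subst hux
  have hu0 : 0 < Complex.normSq u := Complex.normSq_pos.2 fun h0 => by simp [h0] at hx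
  have e : (u * Y * star (D - (β : ℂ)⁻¹ * Y)).re =
      (u * Y * star D).re - β⁻¹ * (Complex.normSq Y * u.re) := by
    have : u * Y * star (D - (β : ℂ)⁻¹ * Y) =
        u * Y * star D - ((β⁻¹ * Complex.normSq Y : ℝ) : ℂ) * u := by
      simp only [Complex.star_def, map_sub, map_mul, map_inv₀, Complex.conj_ofReal,
        Complex.ofReal_mul, Complex.ofReal_inv, ← Complex.mul_conj]
      ring
    rw [this, Complex.sub_re, Complex.re_ofReal_mul]
    ring
  have h' : Complex.normSq Y * u.re ≤ β * (u * Y * star D).re := by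
    refine le_of_mul_le_mul_left ?_ hu0
    rw [Complex.normSq_mul] at h
    linarith
  rw [e, sub_nonneg, inv_mul_le_iff₀ hβ]
  exact h'

/-- Evaluation of a real polynomial commutes with complex conjugation. -/
theorem aeval_star (P : ℝ[X]) (z : ℂ) : aeval (star z) P = star (aeval z P) :=
  aeval_algHom_apply Complex.conjAe.toAlgHom z P

/-- Removing the poles at `± iω` from the reciprocal of a positive-real quotient
`(s² + ω²) N / D` leaves a quotient with nonnegative real part on the right half-plane. -/
theorem exists_boundary_pole_removal {N D : ℝ[X]} {ω : ℝ} (hω : 0 < ω) (hN : N ≠ 0)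
    (hD : aeval ((ω : ℂ) * Complex.I) D ≠ 0)
    (hND : ∀ z : ℂ, 0 < z.re → aeval z ((X ^ 2 + C (ω ^ 2)) * N) + aeval z D ≠ 0)
    (hre : ∀ z : ℂ, 0 < z.re →
      0 ≤ (aeval z ((X ^ 2 + C (ω ^ 2)) * N) * star (aeval z D)).re) :
    ∃ (α : ℝ) (E : ℝ[X]), 0 < α ∧ D = C (2 * α) * X * N + (X ^ 2 + C (ω ^ 2)) * E ∧
      (∀ z : ℂ, 0 < z.re → aeval z N ≠ 0) ∧
      ∀ z : ℂ, 0 < z.re → 0 ≤ (aeval z N * star (aeval z E)).re := by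
  set M : ℝ[X] := (X ^ 2 + C (ω ^ 2)) * N with hM
  have hN0 : ∀ z : ℂ, 0 < z.re → aeval z M ≠ 0 := by
    intro w hw h0
    have hMz : M = 0 := eq_zero_of_aeval_eq_zero_of_re_pos fun z hz =>
      eq_zero_of_re_mul_star_nonneg D.differentiable_aeval M.differentiable_aeval
        (fun z hz => by rw [add_comm]; exact hND z hz)
        (fun z hz => by
          have := hre z hz
          rw [← Complex.conj_re, ← Complex.star_def, star_mul', star_star, mul_comm] at this
          exact this) hz hw h0
    rcases mul_eq_zero.1 hMz with h | h
    · exact (monic_X_pow_add_C (ω ^ 2) two_ne_zero).ne_zero h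
    · exact hN h
  have hMe : ∀ z : ℂ, aeval z M =
      (z - ω * Complex.I) * ((z + ω * Complex.I) * aeval z N) := by
    intro z
    simp only [hM, map_mul, map_add, map_pow, aeval_X, aeval_C, Complex.coe_algebraMap]
    linear_combination ((ω : ℂ) ^ 2 * aeval z N) * Complex.I_sq
  have hNd := N.differentiable_aeval (𝕜 := ℂ)
  have hDd := D.differentiable_aeval (𝕜 := ℂ)
  obtain ⟨β, hβ, hβe, hβm⟩ := exists_pos_deriv_at_boundary_zero
    (f₁ := fun z => (z + ω * Complex.I) * aeval z N) (g := fun z => aeval z D)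
    (z₀ := ω * Complex.I) (by fun_prop) hDd (by simp) hD
    (fun z hz => by rw [← hMe]; exact hND z hz)
    (fun z hz => by rw [← hMe]; exact hre z hz)
    ⟨1, by simp, fun h => hN0 1 (by simp) (by rw [hMe, h, mul_zero])⟩
  have hsum : ∀ z : ℂ, 0 < z.re →
      0 ≤ (aeval z M * star (aeval z D - (β : ℂ)⁻¹ * ((z + ω * Complex.I) * aeval z N))).re := by
    intro z hz
    rw [hMe]
    exact re_mul_star_sub_nonneg hβ (by simp) hz (hβm z hz)
  have hMe' : ∀ z : ℂ, aeval z M =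
      (z - -(ω * Complex.I)) * ((z - ω * Complex.I) * aeval z N) := by
    intro z
    rw [hMe]
    ring
  have hsum_ne : ∀ z : ℂ, 0 < z.re →
      aeval z M + (aeval z D - (β : ℂ)⁻¹ * ((z + ω * Complex.I) * aeval z N)) ≠ 0 := by
    intro z hz h0
    have h1 := hsum z hz
    rw [eq_neg_of_add_eq_zero_right h0, star_neg, mul_neg, Complex.star_def, Complex.mul_conj,
      Complex.neg_re, Complex.ofReal_re] at h1
    exact (Complex.normSq_pos.2 (hN0 z hz)).not_ge (by linarith)
  have hstar : star ((ω : ℂ) * Complex.I) = -(ω * Complex.I) := by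
    simp
  have hDs : aeval (-((ω : ℂ) * Complex.I)) D ≠ 0 := by
    rw [← hstar, aeval_star]
    exact star_ne_zero.2 hD
  obtain ⟨γ, hγ, hγe, hγm⟩ := exists_pos_deriv_at_boundary_zero
    (f₁ := fun z => (z - ω * Complex.I) * aeval z N)
    (g := fun z => aeval z D - (β : ℂ)⁻¹ * ((z + ω * Complex.I) * aeval z N))
    (z₀ := -(ω * Complex.I)) (by fun_prop) (by fun_prop) (by simp) (by simpa using hDs)
    (fun z hz => by rw [← hMe']; exact hsum_ne z hz)
    (fun z hz => by rw [← hMe']; exact hsum z hz)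
    ⟨1, by simp, fun h => hN0 1 (by simp) (by rw [hMe', h, mul_zero])⟩
  have hγβ : γ = β := by
    have h1 := congrArg star hβe
    simp only [neg_add_cancel, zero_mul, mul_zero, sub_zero] at hγe
    have hβs : star (β : ℂ) = β := Complex.conj_ofReal β
    simp only [star_mul', star_add, ← aeval_star, hβs] at h1
    simp only [← star_mul', hstar] at h1
    have h2 : (γ : ℂ) * aeval (-((ω : ℂ) * Complex.I)) D =
        β * aeval (-((ω : ℂ) * Complex.I)) D := by
      rw [← hγe]
      rw [← h1]
      ring
    exact_mod_cast mul_right_cancel₀ hDs h2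
  subst hγβ
  obtain ⟨E, hE⟩ := exists_eq_X_sq_add_C_mul (P := D - C (2 * γ⁻¹) * X * N) hω.ne' (by
    simp only [map_sub, map_mul, aeval_X, aeval_C, Complex.coe_algebraMap]
    have : (γ : ℂ) ≠ 0 := by exact_mod_cast hγ.ne'
    push_cast
    field_simp
    linear_combination -hβe)
  refine ⟨γ⁻¹, E, inv_pos.2 hγ, by rw [← hE]; ring, fun z hz h0 => hN0 z hz (by simp [hM, h0]),
    fun z hz => ?_⟩
  have h := re_mul_star_sub_nonneg hγ (by simp) hz (hγm z hz)
  have hEz := congrArg (aeval z) hE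
  simp only [map_sub, map_mul, map_add, map_pow, aeval_X, aeval_C, Complex.coe_algebraMap] at hEz
  have hz2 : z ^ 2 + (ω : ℂ) ^ 2 ≠ 0 := by
    intro h0
    exact hN0 z hz (by simp [hM, h0])
  have e : (z - -(ω * Complex.I)) * ((z - ω * Complex.I) * aeval z N) *
      star (aeval z D - (γ : ℂ)⁻¹ * ((z + ω * Complex.I) * aeval z N) -
        (γ : ℂ)⁻¹ * ((z - ω * Complex.I) * aeval z N)) =
      ((Complex.normSq (z ^ 2 + (ω : ℂ) ^ 2) : ℝ) : ℂ) * (aeval z N * star (aeval z E)) := by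
    have e1 : aeval z D - (γ : ℂ)⁻¹ * ((z + ω * Complex.I) * aeval z N) -
        (γ : ℂ)⁻¹ * ((z - ω * Complex.I) * aeval z N) =
        (z ^ 2 + (ω : ℂ) ^ 2) * aeval z E := by
      push_cast at hEz
      rw [← hEz]
      ring
    rw [e1, ← Complex.mul_conj, star_mul', ← hMe', hM]
    simp only [map_mul, map_add, map_pow, aeval_X, aeval_C, Complex.coe_algebraMap,
      Complex.star_def]
    ring
  rw [e, Complex.re_ofReal_mul] at h
  exact nonneg_of_mul_nonneg_right h (Complex.normSq_pos.2 hz2)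

/-- **Richards' transformation**, in polynomial form, for `H = p / q` with `H(μ) = h`. -/
theorem exists_richards_transform {p q : ℝ[X]} {μ h : ℝ} (hμ : 0 < μ) (hh : 0 < h)
    (hph : p.eval μ = h * q.eval μ) (hq : ∀ z : ℂ, 0 < z.re → aeval z q ≠ 0)
    (hre : ∀ z : ℂ, 0 < z.re → 0 ≤ (aeval z p * star (aeval z q)).re) :
    ∃ N D : ℝ[X], C μ * p - X * C h * q = (X - C μ) * N ∧
      C (μ * h) * q - X * p = (X - C μ) * D ∧
      (∀ z : ℂ, 0 < z.re → aeval z N + aeval z D ≠ 0) ∧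
      ∀ z : ℂ, 0 < z.re → 0 ≤ (aeval z N * star (aeval z D)).re := by
  obtain ⟨N, hN⟩ := dvd_iff_isRoot.2 (show (C μ * p - X * C h * q).IsRoot μ by
    simp [IsRoot.def, hph]
    ring)
  obtain ⟨D, hD⟩ := dvd_iff_isRoot.2 (show (C (μ * h) * q - X * p).IsRoot μ by
    simp [IsRoot.def, hph]
    ring)
  have hadd : ∀ a : ℝ, 0 < a → ∀ z : ℂ, 0 < z.re → aeval z p + a * aeval z q ≠ 0 := by
    intro a ha z hz h0
    have h1 := hre z hz
    rw [eq_neg_of_add_eq_zero_left h0, neg_mul, mul_assoc, Complex.star_def, Complex.mul_conj,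
      Complex.neg_re, Complex.re_ofReal_mul, Complex.ofReal_re] at h1
    have := mul_pos ha (Complex.normSq_pos.2 (hq z hz))
    linarith
  have hsum : N + D = -(p + C h * q) := by
    refine mul_left_cancel₀ (X_sub_C_ne_zero μ) ?_
    rw [mul_add, ← hN, ← hD, C_mul]
    ring
  have hre' : ∀ z : ℂ, 0 < z.re → z ≠ μ → 0 ≤ (aeval z N * star (aeval z D)).re := by
    intro z hz hne
    have hP := pick_inequality p.differentiable_aeval q.differentiable_aeval
      (fun z hz => by simpa using hadd 1 one_pos z hz) hre hz (w := μ) (by simpa using hμ)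
    have hqμ : (q.eval μ : ℝ) ≠ 0 := by
      have := hq μ (by simpa using hμ)
      rw [← Complex.coe_algebraMap, aeval_algebraMap_apply] at this
      simpa using this
    have hpz : aeval (μ : ℂ) p = ((h * q.eval μ : ℝ) : ℂ) := by
      rw [← hph, ← Complex.coe_algebraMap, aeval_algebraMap_apply]
      simp
    have hqz : aeval (μ : ℂ) q = ((q.eval μ : ℝ) : ℂ) := by
      rw [← Complex.coe_algebraMap, aeval_algebraMap_apply]
      simp
    have hNz := congrArg (aeval z) hN
    have hDz := congrArg (aeval z) hD
    simp only [map_sub, map_mul, aeval_X, aeval_C, Complex.coe_algebraMap] at hNz hDz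
    rw [hpz, hqz] at hP
    have hzμ : 0 < Complex.normSq (z - μ) := Complex.normSq_pos.2 (sub_ne_zero.2 hne)
    have e : Complex.normSq (z - μ) * (aeval z N * star (aeval z D)).re =
        ((μ * aeval z p - z * h * aeval z q) * star ((μ : ℂ) * h * aeval z q - z * aeval z p)).re
        := by
      rw [← Complex.re_ofReal_mul, ← Complex.mul_conj, hNz]
      rw [hDz]
      simp only [Complex.star_def, map_mul]
      congr 1
      ring
    refine nonneg_of_mul_nonneg_right (a := Complex.normSq (z - μ)) ?_ hzμ
    rw [e]
    have hq2 : 0 < q.eval μ ^ 2 := by positivity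
    refine nonneg_of_mul_nonneg_right (a := q.eval μ ^ 2) ?_ hq2
    generalize aeval z p = P at *
    generalize aeval z q = Q at *
    generalize q.eval μ = a at *
    simp only [Complex.normSq_apply, Complex.sub_re, Complex.sub_im, Complex.star_def,
      Complex.conj_re, Complex.conj_im, Complex.mul_re, Complex.mul_im, Complex.ofReal_re,
      Complex.ofReal_im] at hP ⊢
    linarith
  refine ⟨N, D, hN, hD, fun z hz => ?_, fun z hz => ?_⟩
  · rw [← map_add, hsum]
    simpa [-neg_add_rev] using hadd h hh z hz
  · by_cases hzμ : z = μ
    · have hcont : Continuous fun z : ℂ => (aeval z N * star (aeval z D)).re := by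
        have h1 := (N.differentiable_aeval (𝕜 := ℂ)).continuous
        have h2 := (D.differentiable_aeval (𝕜 := ℂ)).continuous
        exact Complex.continuous_re.comp (by fun_prop)
      refine ge_of_tendsto ((hcont.tendsto z).mono_left (nhdsWithin_le_nhds (s := {z}ᶜ))) ?_
      filter_upwards [self_mem_nhdsWithin, mem_nhdsWithin_of_mem_nhds
        ((isOpen_lt continuous_const Complex.continuous_re).mem_nhds hz)] with x hx1 hx2
      exact hre' x hx2 fun h => hx1 (h.trans hzμ.symm)
    · exact hre' z hz hzμ

/-- A quotient of polynomials with nonvanishing denominator and nonnegative real part on the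
right half-plane is positive-real. -/
theorem isPR_div {N D : ℝ[X]} (hD : ∀ z : ℂ, 0 < z.re → aeval z D ≠ 0)
    (hre : ∀ z : ℂ, 0 < z.re → 0 ≤ (aeval z N * star (aeval z D)).re) :
    IsPR (algebraMap ℝ[X] (RatFunc ℝ) N / algebraMap ℝ[X] (RatFunc ℝ) D) := by
  set H := algebraMap ℝ[X] (RatFunc ℝ) N / algebraMap ℝ[X] (RatFunc ℝ) D with hH
  have hD0 : D ≠ 0 := by
    rintro rfl
    exact hD 1 (by simp) (by simp)
  have hden : ∀ z : ℂ, 0 < z.re → aeval z H.denom ≠ 0 := by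
    intro z hz h0
    obtain ⟨Q, hQ⟩ := RatFunc.denom_div_dvd N D
    exact hD z hz (by rw [hQ, map_mul, ← hH, h0, zero_mul])
  refine ⟨hden, fun z hz => ?_⟩
  have h1 := congrArg (aeval z) ((RatFunc.num_mul_eq_mul_denom_iff hD0).2 hH)
  rw [map_mul, map_mul] at h1
  have h2 : evalC H z = aeval z N / aeval z D :=
    (div_eq_div_iff (hden z hz) (hD z hz)).2 h1
  rw [h2, ← mul_div_mul_right _ _ (star_ne_zero.2 (hD z hz)), Complex.star_def,
    Complex.mul_conj, Complex.div_ofReal_re]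
  exact div_nonneg (hre z hz) (Complex.normSq_nonneg _)

/-- If `p / q` has equal degrees, is positive at `0` and has no poles on `[0, ∞)`, then
`p / q` meets every line of positive slope through the origin. -/
theorem exists_pos_eval_div_eq_mul {p q : ℝ[X]} {c : ℝ} (hc : 0 < c)
    (hdeg : p.natDegree = q.natDegree) (hq : ∀ x : ℝ, 0 ≤ x → q.eval x ≠ 0)
    (h0 : 0 < p.eval 0 / q.eval 0) : ∃ x : ℝ, 0 < x ∧ p.eval x / q.eval x = c * x := by
  have hp0 : p ≠ 0 := by
    rintro rfl
    simp at h0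
  have hq0 : q ≠ 0 := by
    rintro rfl
    simp at h0
  have hlim := div_tendsto_atTop_leadingCoeff_div_of_degree_eq p q
    (by rw [degree_eq_natDegree hp0, degree_eq_natDegree hq0, hdeg])
  have hlin : Filter.Tendsto (fun x : ℝ => c * x) Filter.atTop Filter.atTop :=
    Filter.tendsto_id.const_mul_atTop hc
  obtain ⟨b, hb1, hb2, hb3⟩ := ((hlim.eventually_lt_const (lt_add_one _)).and
    ((hlin.eventually_gt_atTop
    (p.leadingCoeff / q.leadingCoeff + 1)).and (Filter.eventually_gt_atTop 0))).exists
  have hcont : ContinuousOn (fun x => c * x - p.eval x / q.eval x) (Set.Icc 0 b) :=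
    (by fun_prop : ContinuousOn (fun x : ℝ => c * x) _).sub
      (p.continuous.continuousOn.div q.continuous.continuousOn fun x hx => hq x hx.1)
  obtain ⟨x, hx, hx0⟩ := intermediate_value_Icc hb3.le hcont
    (show (0 : ℝ) ∈ Set.Icc _ _ from ⟨by simpa using h0.le, by linarith⟩)
  have hxe : p.eval x / q.eval x = c * x := by
    simp only at hx0
    linarith
  refine ⟨x, lt_of_le_of_ne hx.1 ?_, hxe⟩
  rintro rfl
  rw [hxe] at h0
  simp at h0

/-- If `H` is a minimum function with minimum frequency `ω₀` and
`H(jω₀) = jω₀X` with `X > 0`, then there exist `μ, α > 0` and a PR function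
`H_r` of McMillan degree at most that of `H` minus two, realizing the stated
identity of rational functions. -/
theorem stmt0 (H : RatFunc ℝ) (ω₀ X : ℝ) (hmin : IsMinFun H ω₀)
    (hval : evalC H ((ω₀ : ℂ) * Complex.I) = Complex.I * (ω₀ : ℂ) * (X : ℂ))
    (hX : 0 < X) :
    ∃ (μ α : ℝ) (Hr : RatFunc ℝ), 0 < μ ∧ 0 < α ∧ IsPR Hr ∧
      McMillanDeg Hr + 2 ≤ McMillanDeg H ∧
      H = RatFunc.C (evalR H μ) *
          (RatFunc.X ^ 3 + Hr * RatFunc.C (2 * α + μ) * RatFunc.X ^ 2 +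
            RatFunc.C (ω₀ ^ 2) * RatFunc.X + Hr * RatFunc.C (μ * ω₀ ^ 2)) /
          (Hr * RatFunc.X ^ 3 + RatFunc.C μ * RatFunc.X ^ 2 +
            Hr * RatFunc.C (2 * α * μ + ω₀ ^ 2) * RatFunc.X +
            RatFunc.C (μ * ω₀ ^ 2)) := by
  obtain ⟨⟨hpole, hpr⟩, hH0, ⟨hdeg, hpim, hqim⟩, hω, -⟩ := hmin
  set p := H.num with hp
  set q := H.denom with hqdef
  have hq : ∀ z : ℂ, 0 < z.re → aeval z q ≠ 0 := hpole
  have hreal : ∀ (P : ℝ[X]) (x : ℝ), aeval (x : ℂ) P = ((P.eval x : ℝ) : ℂ) := by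
    intro P x
    rw [← Complex.coe_algebraMap, aeval_algebraMap_apply]
    simp
  have hq0 : q.eval 0 ≠ 0 := by
    have h := hqim 0
    intro h0
    apply h
    have := hreal q 0
    rw [h0] at this
    simpa [aeval_def] using this
  have hp0 : p.eval 0 ≠ 0 := by
    have h := hpim 0
    intro h0
    apply h
    have := hreal p 0
    rw [h0] at this
    simpa [aeval_def] using this
  have hqpos : ∀ x : ℝ, 0 ≤ x → q.eval x ≠ 0 := by
    intro x hx h0
    rcases hx.eq_or_lt with rfl | hx
    · exact hq0 h0
    · exact hq x (by simpa using hx) (by rw [hreal, h0]; simp)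
  have hre : ∀ z : ℂ, 0 < z.re → 0 ≤ (aeval z p * star (aeval z q)).re := by
    intro z hz
    have h : 0 ≤ (aeval z p / aeval z q).re := hpr z hz
    rw [← mul_div_mul_right _ _ (star_ne_zero.2 (hq z hz)), Complex.star_def,
      Complex.mul_conj, Complex.div_ofReal_re] at h
    have h2 := Complex.normSq_pos.2 (hq z hz)
    have := mul_nonneg h h2.le
    rwa [div_mul_cancel₀ _ h2.ne'] at this
  have hH00 : 0 < p.eval 0 / q.eval 0 := by
    refine lt_of_le_of_ne ?_ (div_ne_zero hp0 hq0).symm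
    have hcont : ContinuousAt (fun x : ℝ => p.eval x / q.eval x) 0 :=
      p.continuous.continuousAt.div q.continuous.continuousAt hq0
    refine ge_of_tendsto (hcont.tendsto.mono_left (nhdsWithin_le_nhds (s := Set.Ioi 0))) ?_
    filter_upwards [self_mem_nhdsWithin] with x hx
    have h : 0 ≤ (aeval (x : ℂ) p / aeval (x : ℂ) q).re := hpr x (by simpa using hx)
    rw [hreal, hreal, ← Complex.ofReal_div, Complex.ofReal_re] at h
    exact h
  obtain ⟨μ, hμ, hμe⟩ := exists_pos_eval_div_eq_mul hX hdeg hqpos hH00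
  have hh : 0 < X * μ := mul_pos hX hμ
  have hph : p.eval μ = X * μ * q.eval μ := (div_eq_iff (hqpos μ hμ.le)).1 hμe
  obtain ⟨N, D, hN, hD, hND, hNDre⟩ := exists_richards_transform hμ hh hph hq hre
  have hpω : aeval ((ω₀ : ℂ) * Complex.I) p =
      Complex.I * ω₀ * X * aeval ((ω₀ : ℂ) * Complex.I) q := (div_eq_iff (hqim ω₀)).1 hval
  have hIμ : (ω₀ : ℂ) * Complex.I - μ ≠ 0 := by
    intro h0
    have := congrArg Complex.re h0
    simp at this
    exact hμ.ne' this
  have hNω : aeval ((ω₀ : ℂ) * Complex.I) N = 0 := by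
    have h := congrArg (aeval ((ω₀ : ℂ) * Complex.I)) hN
    simp only [map_sub, map_mul, aeval_X, aeval_C, Complex.coe_algebraMap] at h
    refine (mul_eq_zero.1 (h.symm.trans ?_)).resolve_left hIμ
    rw [hpω]
    ring
  have hDω : aeval ((ω₀ : ℂ) * Complex.I) D ≠ 0 := by
    intro h0
    have h := congrArg (aeval ((ω₀ : ℂ) * Complex.I)) hD
    simp only [map_sub, map_mul, aeval_X, aeval_C, Complex.coe_algebraMap] at h
    rw [h0, hpω, mul_zero] at h
    have h1 : ((X * (μ ^ 2 + ω₀ ^ 2) : ℝ) : ℂ) * aeval ((ω₀ : ℂ) * Complex.I) q = 0 := by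
      rw [← h]
      push_cast
      linear_combination ((ω₀ : ℂ) ^ 2 * X * aeval ((ω₀ : ℂ) * Complex.I) q) * Complex.I_sq
    rcases mul_eq_zero.1 h1 with h2 | h2
    · have : X * (μ ^ 2 + ω₀ ^ 2) ≠ 0 := by positivity
      exact this (by exact_mod_cast h2)
    · exact hqim ω₀ h2
  obtain ⟨N₁, rfl⟩ := exists_eq_X_sq_add_C_mul hω.ne' hNω
  have hN₁ : N₁ ≠ 0 := by
    rintro rfl
    have h := congrArg (eval 0) hN
    simp [hμ.ne', hp0] at h
  obtain ⟨α, D₁, hα, hD₁, hN₁ne, hre₁⟩ := exists_boundary_pole_removal hω hN₁ hDω hND hNDre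
  have hD₁0 : D₁ ≠ 0 := by
    rintro rfl
    have h := congrArg (eval 0) hD
    rw [hD₁] at h
    simp [hμ.ne', hX.ne', hq0] at h
  have hD₁ne : ∀ z : ℂ, 0 < z.re → aeval z D₁ ≠ 0 := by
    intro w hw h0
    refine hD₁0 (eq_zero_of_aeval_eq_zero_of_re_pos fun z hz =>
      eq_zero_of_re_mul_star_nonneg N₁.differentiable_aeval D₁.differentiable_aeval
        (fun z hz h1 => ?_) hre₁ hz hw h0)
    have h2 := hre₁ z hz
    rw [eq_neg_of_add_eq_zero_right h1, star_neg, mul_neg, Complex.star_def, Complex.mul_conj,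
      Complex.neg_re, Complex.ofReal_re] at h2
    exact (Complex.normSq_pos.2 (hN₁ne z hz)).not_ge (by linarith)
  have hnum : X * μ = evalR H μ := hμe.symm
  have hpne : p ≠ 0 := RatFunc.num_ne_zero hH0
  have hqne : q ≠ 0 := H.denom_ne_zero
  have hdegN : N₁.natDegree + 2 ≤ q.natDegree := by
    have h1 : (C μ * p - Polynomial.X * C (X * μ) * q).natDegree ≤ q.natDegree + 1 := by
      refine (natDegree_sub_le _ _).trans (max_le ?_ ?_)
      · exact (natDegree_C_mul_le _ _).trans (by omega)
      · rw [mul_assoc]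
        refine natDegree_mul_le.trans ?_
        have := natDegree_C_mul_le (X * μ) q
        rw [natDegree_X]
        omega
    rw [hN, natDegree_mul (X_sub_C_ne_zero μ) (mul_ne_zero
      (monic_X_pow_add_C (ω₀ ^ 2) two_ne_zero).ne_zero hN₁), natDegree_X_sub_C,
      natDegree_mul (monic_X_pow_add_C (ω₀ ^ 2) two_ne_zero).ne_zero hN₁,
      natDegree_X_pow_add_C] at h1
    omega
  have hdegD : D.natDegree ≤ q.natDegree := by
    have h1 : (C (μ * (X * μ)) * q - Polynomial.X * p).natDegree ≤ q.natDegree + 1 := by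
      refine (natDegree_sub_le _ _).trans (max_le ?_ ?_)
      · exact (natDegree_C_mul_le _ _).trans (by omega)
      · refine natDegree_mul_le.trans ?_
        rw [natDegree_X]
        omega
    rw [hD] at h1
    by_cases hD0 : D = 0
    · simp [hD0]
    · rw [natDegree_mul (X_sub_C_ne_zero μ) hD0, natDegree_X_sub_C] at h1
      omega
  have hdegD₁ : D₁.natDegree + 2 ≤ q.natDegree := by
    have h1 : ((Polynomial.X ^ 2 + C (ω₀ ^ 2)) * D₁).natDegree ≤ q.natDegree := by
      have : (Polynomial.X ^ 2 + C (ω₀ ^ 2)) * D₁ = D - C (2 * α) * (Polynomial.X * N₁) := by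
        rw [hD₁]
        ring
      rw [this]
      refine (natDegree_sub_le _ _).trans (max_le hdegD ?_)
      refine (natDegree_C_mul_le _ _).trans (natDegree_mul_le.trans ?_)
      rw [natDegree_X]
      omega
    rw [natDegree_mul (monic_X_pow_add_C (ω₀ ^ 2) two_ne_zero).ne_zero hD₁0,
      natDegree_X_pow_add_C] at h1
    omega
  refine ⟨μ, α, algebraMap ℝ[X] (RatFunc ℝ) N₁ / algebraMap ℝ[X] (RatFunc ℝ) D₁, hμ, hα,
    isPR_div hD₁ne hre₁, ?_, ?_⟩
  · have h1 := natDegree_le_of_dvd (RatFunc.num_div_dvd N₁ hD₁0) hN₁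
    have h2 := natDegree_le_of_dvd (RatFunc.denom_div_dvd N₁ D₁) hD₁0
    have h3 : q.natDegree ≤ McMillanDeg H := le_max_right _ _
    have h4 : McMillanDeg (algebraMap ℝ[X] (RatFunc ℝ) N₁ / algebraMap ℝ[X] (RatFunc ℝ) D₁) ≤
      max N₁.natDegree D₁.natDegree := max_le_max h1 h2
    omega
  · rw [← hnum]
    have hXμ : (Polynomial.X - C μ : ℝ[X]) ≠ 0 := X_sub_C_ne_zero μ
    have hXμ' : (Polynomial.X + C μ : ℝ[X]) ≠ 0 := X_add_C_ne_zero μ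
    have hnumer : Polynomial.X * D + C μ * ((Polynomial.X ^ 2 + C (ω₀ ^ 2)) * N₁) =
        -((Polynomial.X + C μ) * p) := by
      refine mul_left_cancel₀ hXμ ?_
      have hC : (C (μ * (X * μ)) : ℝ[X]) = C μ * C (X * μ) := C_mul
      rw [hC] at hD
      linear_combination (-Polynomial.X) * hD - C μ * hN
    have hdenom : Polynomial.X * ((Polynomial.X ^ 2 + C (ω₀ ^ 2)) * N₁) + C μ * D =
        -(C (X * μ) * (Polynomial.X + C μ) * q) := by
      refine mul_left_cancel₀ hXμ ?_
      have hC : (C (μ * (X * μ)) : ℝ[X]) = C μ * C (X * μ) := C_mul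
      rw [hC] at hD
      linear_combination (-Polynomial.X) * hN - C μ * hD
    rw [hD₁] at hnumer hdenom
    have hn := congrArg (algebraMap ℝ[X] (RatFunc ℝ)) hnumer
    have hd := congrArg (algebraMap ℝ[X] (RatFunc ℝ)) hdenom
    have hXμ2 := RatFunc.algebraMap_ne_zero hXμ'
    have hq2 := RatFunc.algebraMap_ne_zero hqne
    have hD2 := RatFunc.algebraMap_ne_zero hD₁0
    have hh2 := RatFunc.algebraMap_ne_zero (C_ne_zero.2 hh.ne')
    have hHpq : algebraMap ℝ[X] (RatFunc ℝ) p / algebraMap ℝ[X] (RatFunc ℝ) q = H :=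
      H.num_div_denom
    simp only [map_add, map_mul, map_pow, map_neg, RatFunc.algebraMap_X,
      RatFunc.algebraMap_C, map_ofNat] at hn hd hXμ2 hh2
    rw [← hHpq]
    simp only [map_add, map_mul, map_pow, map_ofNat]
    generalize algebraMap ℝ[X] (RatFunc ℝ) p = P at *
    generalize algebraMap ℝ[X] (RatFunc ℝ) q = Q at *
    generalize algebraMap ℝ[X] (RatFunc ℝ) N₁ = n at *
    generalize algebraMap ℝ[X] (RatFunc ℝ) D₁ = d at *
    generalize RatFunc.C μ = m at *
    generalize RatFunc.C α = a at *
    generalize RatFunc.C ω₀ = w at *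
    generalize RatFunc.C X = x at *
    generalize (RatFunc.X : RatFunc ℝ) = s at *
    have e1 : s ^ 3 + n / d * (2 * a + m) * s ^ 2 + w ^ 2 * s + n / d * (m * w ^ 2) =
        -((s + m) * P) / d := by
      rw [← hn]
      field_simp
      ring
    have e2 : n / d * s ^ 3 + m * s ^ 2 + n / d * (2 * a * m + w ^ 2) * s + m * w ^ 2 =
        -(x * m * (s + m) * Q) / d := by
      rw [← hd]
      field_simp
      ring
    rw [e1, e2]
    have hm := right_ne_zero_of_mul hh2
    have hx := left_ne_zero_of_mul hh2
    field_simp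
end

section
/- Let H be a biquadratic minimum function. Then there exist real numbers K > 0 and ω₀ > 0 and real numbers W, F satisfying either (i) 0 < W < 1 and F > 0, or (ii) W > 1 and F < 0, such that H(s) = K·(s² + (ω₀(1−W)F/W)·s + ω₀²W) / (s² + (ω₀(1−W)/F)·s + ω₀²/W). -/
open Polynomial Matrix

lemma Polynomial.eq_quadratic_of_natDegree_eq_two {p : ℝ[X]} (hp : p.natDegree = 2) :
    p = C (p.coeff 2) * X ^ 2 + C (p.coeff 1) * X + C (p.coeff 0) :=
  eq_quadratic_of_degree_le_two (natDegree_le_iff_degree_le.1 hp.le)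

/-- A monic real quadratic without roots in the closed right half-plane has positive
coefficients. -/
lemma monic_quadratic_coeff_pos {d e : ℝ}
    (hr : ∀ z : ℂ, 0 < z.re → z ^ 2 + d * z + e ≠ 0)
    (hi : ∀ ω : ℝ, ((ω : ℂ) * Complex.I) ^ 2 + d * ((ω : ℂ) * Complex.I) + e ≠ 0) :
    0 < d ∧ 0 < e := by
  have real_root : ∀ x : ℝ, 0 < x → x ^ 2 + d * x + e ≠ 0 := fun x hx h =>
    hr x (by simpa using hx) (by exact_mod_cast h)
  have he : 0 < e := by
    by_contra! he
    rcases he.lt_or_eq with he | he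
    · have hs := Real.sq_sqrt (show 0 ≤ d ^ 2 - 4 * e by nlinarith [sq_nonneg d])
      have hlt : |d| < √(d ^ 2 - 4 * e) := Real.lt_sqrt_of_sq_lt (by rw [sq_abs]; linarith)
      have := le_abs_self d
      exact real_root ((-d + √(d ^ 2 - 4 * e)) / 2) (by linarith) (by nlinarith)
    · exact hi 0 (by simp [he])
  refine ⟨?_, he⟩
  by_contra! hd
  rcases hd.lt_or_eq with hd | hd
  · rcases le_total 0 (d ^ 2 - 4 * e) with h | h
    · have hs := Real.sq_sqrt h
      have := Real.sqrt_nonneg (d ^ 2 - 4 * e)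
      exact real_root ((-d + √(d ^ 2 - 4 * e)) / 2) (by linarith) (by nlinarith)
    · have hs := Real.sq_sqrt (show 0 ≤ 4 * e - d ^ 2 by linarith)
      refine hr ⟨-d / 2, √(4 * e - d ^ 2) / 2⟩ (by simp; linarith) ?_
      apply Complex.ext
      · simp only [pow_two] at hs
        simp [pow_two]
        linarith
      · simp [pow_two]; ring
  · refine hi (√e) ?_
    have hs : ((√e : ℝ) : ℂ) ^ 2 = e := by exact_mod_cast Real.sq_sqrt he.le
    rw [mul_pow, hs, Complex.I_sq, hd]
    simp

lemma IsPR.re_evalC_imag_nonneg {H : RatFunc ℝ} (hH : IsPR H) {ω : ℝ}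
    (hω : H.denom.eval₂ (algebraMap ℝ ℂ) ((ω : ℂ) * Complex.I) ≠ 0) :
    0 ≤ (evalC H ((ω : ℂ) * Complex.I)).re := by
  have hcont : ContinuousAt (fun t : ℝ => (evalC H ((t : ℂ) + ω * Complex.I)).re) 0 := by
    refine Complex.continuous_re.continuousAt.comp (ContinuousAt.div ?_ ?_ (by simpa using hω))
    all_goals
      exact ((Polynomial.continuous_eval₂ _ _).comp (by fun_prop)).continuousAt
  have hlim := hcont.tendsto.mono_left (nhdsWithin_le_nhds (s := Set.Ioi (0 : ℝ)))
  have h := ge_of_tendsto hlim (b := 0) (by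
    filter_upwards [self_mem_nhdsWithin] with t ht
    exact hH.2 _ (by simpa using ht))
  simpa using h

/-- A real biquadratic polynomial that is nonnegative everywhere and vanishes at a positive point
is a multiple of a perfect square. -/
lemma middle_coeff_of_nonneg_of_root {a m c w : ℝ} (hw : 0 < w)
    (hnn : ∀ x : ℝ, 0 ≤ a * x ^ 4 - m * x ^ 2 + c) (h0 : a * w ^ 4 - m * w ^ 2 + c = 0) :
    m = 2 * a * w ^ 2 := by
  have hmin : IsLocalMin (fun x : ℝ => a * x ^ 4 - m * x ^ 2 + c) w :=
    Filter.Eventually.of_forall fun x => by simpa only [h0] using hnn x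
  have hd : HasDerivAt (fun x : ℝ => a * x ^ 4 - m * x ^ 2 + c)
      (a * (4 * w ^ 3) - m * (2 * w)) w := by
    simpa using (((hasDerivAt_pow 4 w).const_mul a).sub
      ((hasDerivAt_pow 2 w).const_mul m)).add_const c
  have h := hmin.hasDerivAt_eq_zero hd
  have : w * (m - 2 * a * w ^ 2) = 0 := by linarith
  rcases mul_eq_zero.1 this with h | h <;> linarith

/-- every biquadratic minimum function admits the parametrisation
of Lemma `bmfp`. -/
theorem stmt4 (H : RatFunc ℝ) (hmin : ∃ ω : ℝ, IsMinFun H ω)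
    (hdeg : McMillanDeg H = 2) :
    ∃ K ω₀ W F : ℝ, 0 < K ∧ 0 < ω₀ ∧
      ((0 < W ∧ W < 1 ∧ 0 < F) ∨ (1 < W ∧ F < 0)) ∧
      H = Hparam K ω₀ W F := by
  obtain ⟨w, hPR, -, ⟨hnd, hp_im, hq_im⟩, hw, hzero⟩ := hmin
  have hq2 : H.denom.natDegree = 2 := by rwa [McMillanDeg, hnd, max_self] at hdeg
  have hp2 : H.num.natDegree = 2 := hnd.trans hq2
  have hp := eq_quadratic_of_natDegree_eq_two hp2
  have hq := eq_quadratic_of_natDegree_eq_two hq2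
  have hlead : H.denom.coeff 2 = 1 := by
    have := H.monic_denom
    rwa [Monic, leadingCoeff, hq2] at this
  have hK0 : H.num.coeff 2 ≠ 0 := by
    rw [← hp2, ← leadingCoeff]
    exact leadingCoeff_ne_zero.2 fun h => by simp [h] at hp2
  rw [hlead, C_1, one_mul] at hq
  generalize H.num.coeff 2 = K at hp hK0
  generalize H.num.coeff 1 = b at hp
  generalize H.num.coeff 0 = c at hp
  generalize H.denom.coeff 1 = d at hq
  generalize H.denom.coeff 0 = e at hq
  have hpe (z : ℂ) : H.num.eval₂ (algebraMap ℝ ℂ) z = K * z ^ 2 + b * z + c := by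
    rw [hp]; simp [eval₂_add, eval₂_mul]
  have hqe (z : ℂ) : H.denom.eval₂ (algebraMap ℝ ℂ) z = z ^ 2 + d * z + e := by
    rw [hq]; simp [eval₂_add, eval₂_mul]
  obtain ⟨hd, he⟩ := monic_quadratic_coeff_pos (fun z hz => hqe z ▸ hPR.1 z hz)
    (fun ω => hqe _ ▸ hq_im ω)
  have hre (x : ℝ) : (evalC H ((x : ℂ) * Complex.I)).re =
      (K * x ^ 4 - (c + K * e - b * d) * x ^ 2 + c * e) /
        Complex.normSq (((x : ℂ) * Complex.I) ^ 2 + d * ((x : ℂ) * Complex.I) + e) := by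
    rw [evalC, hpe, hqe, Complex.div_re, ← add_div]
    congr 1
    simp [pow_two]
    ring
  have hpos (x : ℝ) :
      0 < Complex.normSq (((x : ℂ) * Complex.I) ^ 2 + d * ((x : ℂ) * Complex.I) + e) :=
    Complex.normSq_pos.2 (hqe _ ▸ hq_im x)
  have hnn (x : ℝ) : 0 ≤ K * x ^ 4 - (c + K * e - b * d) * x ^ 2 + c * e := by
    have := hPR.re_evalC_imag_nonneg (hq_im x)
    rw [hre] at this
    simpa using (le_div_iff₀ (hpos x)).1 this
  have h0 : K * w ^ 4 - (c + K * e - b * d) * w ^ 2 + c * e = 0 := by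
    rw [hre] at hzero
    exact (div_eq_zero_iff.1 hzero).resolve_right (hpos w).ne'
  have hm := middle_coeff_of_nonneg_of_root hw hnn h0
  have hce : c * e = K * w ^ 4 := by rw [hm] at h0; linarith
  have hK : 0 < K := by
    have h := hnn 0
    rw [hce] at h
    have : 0 ≤ K := nonneg_of_mul_nonneg_left (by simpa using h) (by positivity : 0 < w ^ 4)
    exact lt_of_le_of_ne this hK0.symm
  have hcK : c = K * w ^ 4 / e := by rw [eq_div_iff he.ne', hce]
  have hbK : b = K * (w ^ 2 - e) ^ 2 / (e * d) := by
    rw [eq_div_iff (by positivity)]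
    linear_combination (-e) * hm + hce
  have hne : e ≠ w ^ 2 := by
    rintro rfl
    refine hp_im w ?_
    have hb : b = 0 := by simp [hbK]
    have hc : c = K * w ^ 2 := by rw [hcK]; field_simp
    rw [hpe, mul_pow, Complex.I_sq, hb, hc]
    push_cast
    ring
  have hW : 1 - w ^ 2 / e ≠ 0 := by
    rw [sub_ne_zero, ne_comm, ne_eq, div_eq_one_iff_eq he.ne']
    exact hne.symm
  refine ⟨K, w, w ^ 2 / e, w * (1 - w ^ 2 / e) / d, hK, hw, ?_, ?_⟩
  · rcases lt_or_gt_of_ne hW with h | h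
    · exact Or.inr ⟨by linarith, div_neg_of_neg_of_pos (mul_neg_of_pos_of_neg hw h) hd⟩
    · exact Or.inl ⟨by positivity, by linarith, by positivity⟩
  · have e1 : K * (w * (1 - w ^ 2 / e) * (w * (1 - w ^ 2 / e) / d) / (w ^ 2 / e)) = b := by
      rw [hbK]; field_simp; ring
    have e2 : K * (w ^ 2 * (w ^ 2 / e)) = c := by rw [hcK]; ring
    have e3 : w * (1 - w ^ 2 / e) / (w * (1 - w ^ 2 / e) / d) = d := by
      field_simp
    have e4 : w ^ 2 / (w ^ 2 / e) = e := by field_simp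
    rw [Hparam, e3, e4, mul_add, mul_add, ← mul_assoc, ← map_mul, ← map_mul, e1, e2,
      ← RatFunc.num_div_denom H, hp, hq]
    simp [RatFunc.algebraMap_X, RatFunc.algebraMap_C]
end

section
/- Suppose H_{K,ω₀,W,F} = H_{K',ω₀',W',F'} as rational functions, where both parameter tuples (K,ω₀,W,F) and (K',ω₀',W',F') satisfy K, ω₀ > 0 together with either (0 < W < 1 and F > 0) or (W > 1 and F < 0). Then K = K', ω₀ = ω₀', W = W', and F = F'. Moreover, for H = H_{K,ω₀,W,F}: the ratio of the leading coefficients of numerator and denominator equals K (i.e., H(∞) = K), H(0) = KW², and H(jω₀) = jKF. -/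
open Polynomial Matrix

/-- Two monic real quadratics with nonzero resultant are coprime. -/
theorem isCoprime_quadratics {a b c d : ℝ}
    (hR : (b - d) ^ 2 + (a - c) * (a * d - b * c) ≠ 0) :
    IsCoprime (X ^ 2 + C a * X + C b : ℝ[X]) (X ^ 2 + C c * X + C d) := by
  set R := (b - d) ^ 2 + (a - c) * (a * d - b * c) with hRdef
  refine ⟨C R⁻¹ * -(C (a - c) * X + C ((a - c) * c - (b - d))),
    C R⁻¹ * (C ((a - c) ^ 2) + C (a - c) * X + C ((a - c) * c - (b - d))), ?_⟩
  have h1 : (C R⁻¹ * C R : ℝ[X]) = 1 := by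
    rw [← C_mul, inv_mul_cancel₀ hR, C_1]
  rw [← h1, hRdef]
  simp only [C_sub, C_add, C_mul, C_pow]
  ring

theorem monic_quadratic (a b : ℝ) : (X ^ 2 + C a * X + C b : ℝ[X]).Monic := by
  monicity!

/-- A fraction with coprime terms and monic denominator is in lowest terms. -/
theorem num_denom_of_coprime {p q : ℝ[X]} (hq : q.Monic) (h : IsCoprime p q) {H : RatFunc ℝ}
    (hH : H = algebraMap ℝ[X] (RatFunc ℝ) p / algebraMap ℝ[X] (RatFunc ℝ) q) :
    H.num = p ∧ H.denom = q := by
  have hcross : H.num * q = p * H.denom := by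
    have h0 := H.num_div_denom.trans hH
    rw [div_eq_div_iff (RatFunc.algebraMap_ne_zero H.denom_ne_zero)
      (RatFunc.algebraMap_ne_zero hq.ne_zero), ← map_mul, ← map_mul] at h0
    exact RatFunc.algebraMap_injective ℝ h0
  have h1 : H.denom ∣ q :=
    H.isCoprime_num_denom.symm.dvd_of_dvd_mul_left (hcross ▸ dvd_mul_left _ _)
  have h2 : q ∣ H.denom := h.symm.dvd_of_dvd_mul_left (hcross ▸ dvd_mul_left _ _)
  have h3 : H.denom = q :=
    eq_of_monic_of_associated H.monic_denom hq (associated_of_dvd_dvd h1 h2)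
  refine ⟨?_, h3⟩
  rw [h3] at hcross
  exact mul_right_cancel₀ hq.ne_zero hcross

theorem Hparam_resultant_ne_zero {ω₀ W F : ℝ} (hω : 0 < ω₀) (hW : 0 < W) (hW1 : W ≠ 1)
    (hF : F ≠ 0) :
    (ω₀ ^ 2 * W - ω₀ ^ 2 / W) ^ 2 +
      (ω₀ * (1 - W) * F / W - ω₀ * (1 - W) / F) *
        (ω₀ * (1 - W) * F / W * (ω₀ ^ 2 / W) - ω₀ ^ 2 * W * (ω₀ * (1 - W) / F)) ≠ 0 := by
  have h : (ω₀ ^ 2 * W - ω₀ ^ 2 / W) ^ 2 +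
      (ω₀ * (1 - W) * F / W - ω₀ * (1 - W) / F) *
        (ω₀ * (1 - W) * F / W * (ω₀ ^ 2 / W) - ω₀ ^ 2 * W * (ω₀ * (1 - W) / F)) =
      ω₀ ^ 4 * (1 - W) ^ 2 * (F ^ 2 / W ^ 3 + 2 / W + W / F ^ 2) := by
    field_simp
    ring
  rw [h]
  have h1 : 1 - W ≠ 0 := sub_ne_zero.mpr hW1.symm
  positivity

theorem Hparam_num_denom {K ω₀ W F : ℝ} (hK : 0 < K) (hω : 0 < ω₀) (hW : 0 < W)
    (hW1 : W ≠ 1) (hF : F ≠ 0) :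
    (Hparam K ω₀ W F).num =
        C K * (X ^ 2 + C (ω₀ * (1 - W) * F / W) * X + C (ω₀ ^ 2 * W)) ∧
      (Hparam K ω₀ W F).denom =
        X ^ 2 + C (ω₀ * (1 - W) / F) * X + C (ω₀ ^ 2 / W) := by
  refine num_denom_of_coprime (monic_quadratic _ _) ?_ ?_
  · exact (isCoprime_mul_unit_left_left (isUnit_C.mpr hK.ne'.isUnit) _ _).mpr
      (isCoprime_quadratics (Hparam_resultant_ne_zero hω hW hW1 hF))
  · simp [Hparam, RatFunc.algebraMap_X, RatFunc.algebraMap_C]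

/-- the parameters `K, ω₀, W, F` are uniquely determined by the
biquadratic minimum function `Hparam K ω₀ W F`; moreover `H(∞) = K`,
`H(0) = KW²` and `H(jω₀) = jKF`. -/
theorem stmt5 (K ω₀ W F K' ω₀' W' F' : ℝ)
    (hK : 0 < K) (hω : 0 < ω₀)
    (hWF : (0 < W ∧ W < 1 ∧ 0 < F) ∨ (1 < W ∧ F < 0))
    (hK' : 0 < K') (hω' : 0 < ω₀')
    (hWF' : (0 < W' ∧ W' < 1 ∧ 0 < F') ∨ (1 < W' ∧ F' < 0))
    (heq : Hparam K ω₀ W F = Hparam K' ω₀' W' F') :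
    K = K' ∧ ω₀ = ω₀' ∧ W = W' ∧ F = F' ∧
    (Hparam K ω₀ W F).num.leadingCoeff / (Hparam K ω₀ W F).denom.leadingCoeff
      = K ∧
    evalR (Hparam K ω₀ W F) 0 = K * W ^ 2 ∧
    evalC (Hparam K ω₀ W F) ((ω₀ : ℂ) * Complex.I)
      = Complex.I * (K : ℂ) * (F : ℂ) := by
  have pos : ∀ {W F : ℝ}, ((0 < W ∧ W < 1 ∧ 0 < F) ∨ (1 < W ∧ F < 0)) →
      0 < W ∧ W ≠ 1 ∧ F ≠ 0 := by
    rintro W F (⟨h1, h2, h3⟩ | ⟨h1, h2⟩)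
    · exact ⟨h1, h2.ne, h3.ne'⟩
    · exact ⟨by linarith, h1.ne', h2.ne⟩
  obtain ⟨hW, hW1, hF⟩ := pos hWF
  obtain ⟨hW', hW1', hF'⟩ := pos hWF'
  obtain ⟨hn, hd⟩ := Hparam_num_denom hK hω hW hW1 hF
  obtain ⟨hn', hd'⟩ := Hparam_num_denom hK' hω' hW' hW1' hF'
  have hnn := hn.symm.trans ((congrArg RatFunc.num heq).trans hn')
  have hdd := hd.symm.trans ((congrArg RatFunc.denom heq).trans hd')
  have hKK : K = K' := by
    have h := congrArg leadingCoeff hnn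
    rwa [leadingCoeff_mul, leadingCoeff_mul, (monic_quadratic _ _).leadingCoeff,
      (monic_quadratic _ _).leadingCoeff, leadingCoeff_C, leadingCoeff_C, mul_one, mul_one] at h
  subst hKK
  have hpp := mul_left_cancel₀ (C_ne_zero.mpr hK.ne') hnn
  have ha : ω₀ * (1 - W) * F / W = ω₀' * (1 - W') * F' / W' := by
    simpa [-mul_eq_mul_right_iff, -mul_eq_mul_left_iff, coeff_X, coeff_C, -map_mul, -map_sub,
      -map_div₀] using congrArg (fun p : ℝ[X] => p.coeff 1) hpp
  have hb : ω₀ ^ 2 * W = ω₀' ^ 2 * W' := by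
    simpa using congrArg (eval 0) hpp
  have hd0 : ω₀ ^ 2 / W = ω₀' ^ 2 / W' := by
    simpa using congrArg (eval 0) hdd
  have hωω : ω₀ = ω₀' := by
    have h4 : ω₀ ^ 4 = ω₀' ^ 4 := by
      calc ω₀ ^ 4 = (ω₀ ^ 2 * W) * (ω₀ ^ 2 / W) := by field_simp
        _ = (ω₀' ^ 2 * W') * (ω₀' ^ 2 / W') := by rw [hb, hd0]
        _ = ω₀' ^ 4 := by field_simp
    exact (pow_left_inj₀ hω.le hω'.le (by norm_num)).mp h4
  subst hωω
  have hWW : W = W' := mul_left_cancel₀ (pow_ne_zero 2 hω.ne') hb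
  subst hWW
  have h1W : 1 - W ≠ 0 := sub_ne_zero.mpr hW1.symm
  have hFF : F = F' := by
    have h := (div_left_inj' hW.ne').mp ha
    exact mul_left_cancel₀ (mul_ne_zero hω.ne' h1W) h
  refine ⟨rfl, rfl, rfl, hFF, ?_, ?_, ?_⟩
  · rw [hn, hd, leadingCoeff_mul, (monic_quadratic _ _).leadingCoeff,
      (monic_quadratic _ _).leadingCoeff, leadingCoeff_C]
    simp
  · rw [evalR, hn, hd]
    simp
    field_simp
  · have hωC : (ω₀ : ℂ) ≠ 0 := by exact_mod_cast hω.ne'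
    have hWC : (W : ℂ) ≠ 0 := by exact_mod_cast hW.ne'
    have hFC : (F : ℂ) ≠ 0 := by exact_mod_cast hF
    have hden : ((ω₀ : ℂ) * Complex.I) ^ 2 + ((ω₀ * (1 - W) / F : ℝ) : ℂ) *
        ((ω₀ : ℂ) * Complex.I) + ((ω₀ ^ 2 / W : ℝ) : ℂ) ≠ 0 := by
      intro h
      have him := congrArg Complex.im h
      simp [pow_two, -Complex.ofReal_mul, -Complex.ofReal_div] at him
      simp [hω.ne', h1W, hF] at him
    rw [evalC, hn, hd]
    simp only [eval₂_add, eval₂_mul, eval₂_pow, eval₂_X, eval₂_C, Complex.coe_algebraMap]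
    rw [div_eq_iff hden]
    push_cast
    simp only [mul_pow, Complex.I_sq]
    field_simp
    ring_nf
    simp only [Complex.I_sq]
    ring
end

section
/- Let K, ω₀ > 0 and let W, F be real numbers satisfying either (0 < W < 1 and F > 0) or (W > 1 and F < 0), and let H := H_{K,ω₀,W,F}. Then for every real ω the denominator of H does not vanish at jω, Re(H(jω)) ≥ 0, and Re(H(jω)) = 0 if and only if ω² = ω₀². In particular, ω₀ is the unique positive frequency at which the real part of H on the imaginary axis vanishes. -/
open Polynomial Matrix

theorem evalC_of_eq_div {H : RatFunc ℝ} {p q : ℝ[X]} {z : ℂ}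
    (hH : H = algebraMap ℝ[X] (RatFunc ℝ) p / algebraMap ℝ[X] (RatFunc ℝ) q)
    (hz : q.eval₂ (algebraMap ℝ ℂ) z ≠ 0) :
    H.denom.eval₂ (algebraMap ℝ ℂ) z ≠ 0 ∧
      evalC H z = p.eval₂ (algebraMap ℝ ℂ) z / q.eval₂ (algebraMap ℝ ℂ) z := by
  have hq : q ≠ 0 := by
    rintro rfl
    simp at hz
  have hden : H.denom.eval₂ (algebraMap ℝ ℂ) z ≠ 0 := by
    obtain ⟨r, hr⟩ := (RatFunc.denom_dvd hq).2 ⟨p, hH⟩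
    intro h
    apply hz
    rw [hr, eval₂_mul, h, zero_mul]
  refine ⟨hden, ?_⟩
  have hcross := (RatFunc.num_mul_eq_mul_denom_iff hq).2 hH
  rw [evalC, div_eq_div_iff hden hz, ← eval₂_mul, ← eval₂_mul, hcross]

theorem re_biquadratic_mul_I (K a b c d ω : ℝ) :
    ((K * (((ω : ℂ) * Complex.I) ^ 2 + a * (ω * Complex.I) + b)) /
        (((ω : ℂ) * Complex.I) ^ 2 + c * (ω * Complex.I) + d)).re =
      K * ((b - ω ^ 2) * (d - ω ^ 2) + a * c * ω ^ 2) /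
        ((d - ω ^ 2) ^ 2 + (c * ω) ^ 2) := by
  simp only [Complex.div_re, Complex.normSq_apply, pow_two, Complex.add_re, Complex.add_im,
    Complex.mul_re, Complex.mul_im, Complex.ofReal_re, Complex.ofReal_im, Complex.I_re,
    Complex.I_im]
  rw [← add_div]
  congr 1 <;> ring

theorem Hparam_mul_I {K ω₀ W F : ℝ} (hω : ω₀ ≠ 0) (hW : W ≠ 0) (hW1 : W ≠ 1) (hF : F ≠ 0)
    (ω : ℝ) :
    (Hparam K ω₀ W F).denom.eval₂ (algebraMap ℝ ℂ) ((ω : ℂ) * Complex.I) ≠ 0 ∧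
      ∃ D : ℝ, 0 < D ∧
        (evalC (Hparam K ω₀ W F) ((ω : ℂ) * Complex.I)).re = K * (ω ^ 2 - ω₀ ^ 2) ^ 2 / D := by
  set a := ω₀ * (1 - W) * F / W with ha
  set b := ω₀ ^ 2 * W with hb
  set c := ω₀ * (1 - W) / F with hc
  set d := ω₀ ^ 2 / W with hd
  have hH : Hparam K ω₀ W F =
      algebraMap ℝ[X] (RatFunc ℝ) (C K * (X ^ 2 + C a * X + C b)) /
        algebraMap ℝ[X] (RatFunc ℝ) (X ^ 2 + C c * X + C d) := by
    simp only [Hparam, ha, hb, hc, hd, map_add (algebraMap ℝ[X] (RatFunc ℝ)),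
      map_mul (algebraMap ℝ[X] (RatFunc ℝ)), map_pow (algebraMap ℝ[X] (RatFunc ℝ)),
      RatFunc.algebraMap_C, RatFunc.algebraMap_X]
  have hc0 : c ≠ 0 := div_ne_zero (mul_ne_zero hω (sub_ne_zero.2 hW1.symm)) hF
  have hd0 : d ≠ 0 := div_ne_zero (pow_ne_zero 2 hω) hW
  have hD : 0 < (d - ω ^ 2) ^ 2 + (c * ω) ^ 2 := by
    rcases eq_or_ne ω 0 with rfl | h
    · have : 0 < d ^ 2 := by positivity
      simpa using this
    · have : 0 < (c * ω) ^ 2 := by positivity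
      positivity
  have hqeval : (X ^ 2 + C c * X + C d : ℝ[X]).eval₂ (algebraMap ℝ ℂ) ((ω : ℂ) * Complex.I) =
      ((ω : ℂ) * Complex.I) ^ 2 + c * (ω * Complex.I) + d := by
    simp only [eval₂_add, eval₂_mul, eval₂_pow, eval₂_X, eval₂_C, Complex.coe_algebraMap]
  have hz : (X ^ 2 + C c * X + C d : ℝ[X]).eval₂ (algebraMap ℝ ℂ) ((ω : ℂ) * Complex.I) ≠ 0 := by
    rw [hqeval]
    intro h
    have hre := congrArg Complex.re h
    have him := congrArg Complex.im h
    simp [pow_two, -mul_eq_zero] at hre him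
    have hre' : d - ω ^ 2 = 0 := by linarith
    rw [hre', him] at hD
    simp at hD
  obtain ⟨hden, heval⟩ := evalC_of_eq_div hH hz
  refine ⟨hden, _, hD, ?_⟩
  rw [heval, hqeval]
  simp only [eval₂_add, eval₂_mul, eval₂_pow, eval₂_X, eval₂_C, Complex.coe_algebraMap]
  rw [re_biquadratic_mul_I]
  congr 2
  rw [ha, hb, hc, hd]
  field_simp
  ring

/-- for admissible parameters, the denominator of
`H := Hparam K ω₀ W F` has no purely imaginary roots, `Re (H (jω)) ≥ 0` for all
real `ω`, with equality exactly when `ω² = ω₀²`; in particular `ω₀` is the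
unique positive frequency at which the real part vanishes. -/
theorem stmt7 (K ω₀ W F : ℝ) (hK : 0 < K) (hω : 0 < ω₀)
    (hWF : (0 < W ∧ W < 1 ∧ 0 < F) ∨ (1 < W ∧ F < 0)) :
    (∀ ω : ℝ,
      (Hparam K ω₀ W F).denom.eval₂ (algebraMap ℝ ℂ) ((ω : ℂ) * Complex.I)
        ≠ 0 ∧
      0 ≤ (evalC (Hparam K ω₀ W F) ((ω : ℂ) * Complex.I)).re ∧
      ((evalC (Hparam K ω₀ W F) ((ω : ℂ) * Complex.I)).re = 0 ↔
        ω ^ 2 = ω₀ ^ 2)) ∧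
    (∀ ω : ℝ, 0 < ω →
      (evalC (Hparam K ω₀ W F) ((ω : ℂ) * Complex.I)).re = 0 → ω = ω₀) := by
  have hW : W ≠ 0 := by
    rintro rfl
    rcases hWF with h | h <;> linarith [h.1]
  have hW1 : W ≠ 1 := by
    rintro rfl
    rcases hWF with ⟨_, h, _⟩ | ⟨h, _⟩ <;> linarith
  have hF : F ≠ 0 := by
    rintro rfl
    rcases hWF with ⟨_, _, h⟩ | ⟨_, h⟩ <;> linarith
  have hzero : ∀ ω : ℝ,
      (evalC (Hparam K ω₀ W F) ((ω : ℂ) * Complex.I)).re = 0 ↔ ω ^ 2 = ω₀ ^ 2 := by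
    intro ω
    obtain ⟨-, D, hD, h⟩ := Hparam_mul_I (K := K) hω.ne' hW hW1 hF ω
    simp [h, hK.ne', hD.ne', sub_eq_zero]
  refine ⟨fun ω => ?_, fun ω hpos h => ?_⟩
  · obtain ⟨hden, D, hD, h⟩ := Hparam_mul_I (K := K) hω.ne' hW hW1 hF ω
    refine ⟨hden, ?_, hzero ω⟩
    rw [h]
    positivity
  · exact (pow_left_inj₀ hpos.le hω.le two_ne_zero).1 ((hzero ω).1 h)
end

section
/- Let Z₁ and Z₂ be PR rational functions and suppose that H := Z₁ + Z₂ is a minimum function with minimum frequency ω₀. Then neither Z₁ nor Z₂ has any pole on jℝ ∪ ∞ (i.e., writing Zᵢ = pᵢ/qᵢ in coprime form, qᵢ has no purely imaginary root and deg pᵢ ≤ deg qᵢ for i = 1, 2), and Re(Z₁(jω₀)) = Re(Z₂(jω₀)) = 0. -/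
open Polynomial Matrix

section

open Filter Topology

/-- Real numbers dominated by a bounded quantity and scaled by a null sequence vanish in the
limit: if `f` is eventually in `[0, M]` and `r ^ k * f r → l` as `r → 0⁺` with `k ≠ 0`,
then `l = 0`. -/
theorem eq_zero_of_tendsto_pow_mul {f : ℝ → ℝ} {M l : ℝ} {k : ℕ} (hk : k ≠ 0)
    (hf : ∀ᶠ r in 𝓝[>] (0 : ℝ), 0 ≤ f r ∧ f r ≤ M)
    (hl : Tendsto (fun r : ℝ => r ^ k * f r) (𝓝[>] 0) (𝓝 l)) : l = 0 := by
  have h0 : Tendsto (fun r : ℝ => r ^ k) (𝓝[>] 0) (𝓝 0) := by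
    have : Tendsto (fun r : ℝ => r ^ k) (𝓝 0) (𝓝 (0 ^ k)) := (continuous_pow k).tendsto 0
    rw [zero_pow hk] at this
    exact this.mono_left nhdsWithin_le_nhds
  have h1 : Tendsto (fun r : ℝ => r ^ k * M) (𝓝[>] 0) (𝓝 0) := by
    simpa using h0.mul_const M
  refine tendsto_nhds_unique hl (tendsto_of_tendsto_of_tendsto_of_le_of_le'
    tendsto_const_nhds h1 ?_ ?_)
  · filter_upwards [hf, self_mem_nhdsWithin] with r hr hpos
    exact mul_nonneg (pow_nonneg (le_of_lt hpos) k) hr.1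
  · filter_upwards [hf, self_mem_nhdsWithin] with r hr hpos
    exact mul_le_mul_of_nonneg_left hr.2 (pow_nonneg (le_of_lt hpos) k)

/-- A ray leaving an imaginary point into the open right half-plane. -/
theorem tendsto_ray_rightHalfPlane {a w : ℂ} (ha : a.re = 0) (hw : 0 < w.re) :
    Tendsto (fun r : ℝ => a + r * w) (𝓝[>] 0) (𝓝[{z : ℂ | 0 < z.re}] a) := by
  refine tendsto_nhdsWithin_iff.2 ⟨?_, ?_⟩
  · have hc : Continuous (fun r : ℝ => a + r * w) := by fun_prop
    have := hc.tendsto 0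
    simp only [Complex.ofReal_zero, zero_mul, add_zero] at this
    exact this.mono_left nhdsWithin_le_nhds
  · filter_upwards [self_mem_nhdsWithin] with r hr
    simpa [ha] using mul_pos (Set.mem_Ioi.1 hr) hw

/-- `evalC` is continuous away from the poles. -/
theorem continuousAt_evalC {H : RatFunc ℝ} {a : ℂ}
    (ha : H.denom.eval₂ (algebraMap ℝ ℂ) a ≠ 0) : ContinuousAt (evalC H) a := by
  have hn (p : ℝ[X]) : Continuous fun z : ℂ => p.eval₂ (algebraMap ℝ ℂ) z :=
    p.continuous_eval₂ (algebraMap ℝ ℂ)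
  exact (hn _).continuousAt.div (hn _).continuousAt ha

theorem evalC_add {Z₁ Z₂ : RatFunc ℝ} {a : ℂ}
    (h1 : Z₁.denom.eval₂ (algebraMap ℝ ℂ) a ≠ 0) (h2 : Z₂.denom.eval₂ (algebraMap ℝ ℂ) a ≠ 0) :
    evalC (Z₁ + Z₂) a = evalC Z₁ a + evalC Z₂ a :=
  RatFunc.eval_add _ _ h1 h2

/-- The value of a rational function at a real point, in terms of real polynomials. -/
theorem evalC_ofReal_re (H : RatFunc ℝ) (x : ℝ) :
    (evalC H x).re = H.num.eval x / H.denom.eval x := by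
  have h (p : ℝ[X]) : p.eval₂ (algebraMap ℝ ℂ) (x : ℂ) = ((p.eval x : ℝ) : ℂ) :=
    p.eval₂_at_apply (algebraMap ℝ ℂ) x
  rw [evalC, h, h, ← Complex.ofReal_div, Complex.ofReal_re]

/-- A rational function whose real part takes values in `[0, M]` on the part of the right
half-plane close to an imaginary point has no pole there. -/
theorem denom_ne_zero_of_re_bounded {Z : RatFunc ℝ} {a : ℂ} (ha : a.re = 0) {M : ℝ}
    (hM : ∀ᶠ z in 𝓝[{z : ℂ | 0 < z.re}] a, 0 ≤ (evalC Z z).re ∧ (evalC Z z).re ≤ M) :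
    Z.denom.eval₂ (algebraMap ℝ ℂ) a ≠ 0 := by
  intro hroot
  have hq : Z.denom.map (algebraMap ℝ ℂ) ≠ 0 :=
    (Polynomial.map_ne_zero_iff (algebraMap ℝ ℂ).injective).2 Z.denom_ne_zero
  obtain ⟨u, hu, hndvd⟩ := exists_eq_pow_rootMultiplicity_mul_and_not_dvd _ hq a
  set k := (Z.denom.map (algebraMap ℝ ℂ)).rootMultiplicity a
  have hk : k ≠ 0 :=
    ((rootMultiplicity_pos hq).2 (by rwa [IsRoot.def, eval_map])).ne'
  have hua : u.eval a ≠ 0 := fun h => hndvd (dvd_iff_isRoot.2 h)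
  have hpa : Z.num.eval₂ (algebraMap ℝ ℂ) a ≠ 0 := by
    obtain ⟨x, y, hxy⟩ := Z.isCoprime_num_denom
    intro h
    have := congrArg (Polynomial.eval₂ (algebraMap ℝ ℂ) a) hxy
    simp [eval₂_add, eval₂_mul, h, hroot] at this
  set g : ℂ → ℂ := fun z => Z.num.eval₂ (algebraMap ℝ ℂ) z / u.eval z with hg
  have hgc : ContinuousAt g a :=
    (Z.num.continuous_eval₂ (algebraMap ℝ ℂ)).continuousAt.div u.continuous.continuousAt hua
  have key (w : ℂ) (hw : 0 < w.re) : (g a / w ^ k).re = 0 := by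
    have hw0 : w ≠ 0 := by rintro rfl; simp at hw
    have hray := tendsto_ray_rightHalfPlane ha hw
    refine eq_zero_of_tendsto_pow_mul hk (hray.eventually hM) ?_
    have hlim : Tendsto (fun r : ℝ => (g (a + r * w) / w ^ k).re) (𝓝[>] 0)
        (𝓝 (g a / w ^ k).re) :=
      (Complex.continuous_re.tendsto _).comp
        ((hgc.tendsto.comp (hray.mono_right nhdsWithin_le_nhds)).div_const _)
    refine hlim.congr' ?_
    filter_upwards [self_mem_nhdsWithin] with r hr
    have hr0 : (r : ℂ) ≠ 0 := Complex.ofReal_ne_zero.2 (ne_of_gt hr)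
    have hden : Z.denom.eval₂ (algebraMap ℝ ℂ) (a + r * w) = (r * w) ^ k * u.eval (a + r * w) := by
      rw [← eval_map, hu]
      simp
    rw [← Complex.re_ofReal_mul, evalC, hden, hg]
    congr 1
    push_cast
    rw [mul_pow]
    field_simp
  have hre : (g a).re = 0 := by simpa using key 1 (by simp)
  have hkR : (1 : ℝ) ≤ k := by exact_mod_cast Nat.one_le_iff_ne_zero.2 hk
  have hθ : 0 < (Complex.exp ((Real.pi / (4 * k) : ℝ) * Complex.I)).re := by
    rw [Complex.exp_ofReal_mul_I_re]
    have hpos : 0 < Real.pi / (4 * k) := by positivity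
    refine Real.cos_pos_of_mem_Ioo ⟨by linarith [Real.pi_pos], ?_⟩
    rw [div_lt_div_iff₀ (by positivity) (by norm_num)]
    nlinarith [Real.pi_pos]
  have hpow : (Complex.exp ((Real.pi / (4 * k) : ℝ) * Complex.I)) ^ k =
      Complex.exp ((Real.pi / 4 : ℝ) * Complex.I) := by
    rw [← Complex.exp_nat_mul]
    congr 1
    have : (k : ℂ) ≠ 0 := by exact_mod_cast hk
    push_cast
    field_simp
  have him := key _ hθ
  rw [hpow, div_eq_mul_inv, ← Complex.exp_neg, ← neg_mul, ← Complex.ofReal_neg,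
    Complex.mul_re, Complex.exp_ofReal_mul_I_im, hre, Real.sin_neg, Real.sin_pi_div_four] at him
  have h2 : (0 : ℝ) < √2 / 2 := by positivity
  have him0 : (g a).im = 0 := by
    have : (g a).im * (√2 / 2) = 0 := by linarith
    exact (mul_eq_zero.1 this).resolve_right h2.ne'
  exact div_ne_zero hpa hua (Complex.ext hre him0)

/-- A rational function taking values in `[0, M]` on large positive reals is proper. -/
theorem natDegree_num_le_of_bounded {Z : RatFunc ℝ} {M : ℝ}
    (hM : ∀ᶠ x : ℝ in atTop, 0 ≤ (evalC Z x).re ∧ (evalC Z x).re ≤ M) :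
    Z.num.natDegree ≤ Z.denom.natDegree := by
  by_contra! h
  have habs := abs_div_tendsto_atTop_atTop_of_degree_gt Z.num Z.denom
    (degree_lt_degree h) Z.denom_ne_zero
  obtain ⟨x, hx, hgt⟩ := (hM.and (habs.eventually_gt_atTop M)).exists
  rw [evalC_ofReal_re] at hx
  rw [abs_of_nonneg hx.1] at hgt
  exact absurd hx.2 hgt.not_ge

/-- The real part of a positive-real function is nonnegative at imaginary points that are
not poles. -/
theorem IsPR.re_nonneg_of_denom_ne_zero {Z : RatFunc ℝ} (hZ : IsPR Z) {a : ℂ} (ha : a.re = 0)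
    (hden : Z.denom.eval₂ (algebraMap ℝ ℂ) a ≠ 0) : 0 ≤ (evalC Z a).re := by
  have hray := tendsto_ray_rightHalfPlane ha (w := 1) (by simp)
  refine ge_of_tendsto ((Complex.continuous_re.tendsto _).comp
    ((continuousAt_evalC hden).tendsto.comp (hray.mono_right nhdsWithin_le_nhds))) ?_
  filter_upwards [hray.eventually self_mem_nhdsWithin] with r hr
  exact hZ.2 _ hr

/-- In the right half-plane, the real part of a positive-real summand is at most that of the
sum. -/
theorem IsPR.re_le_re_add {Z₁ Z₂ : RatFunc ℝ} (h1 : IsPR Z₁) (h2 : IsPR Z₂) {z : ℂ}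
    (hz : 0 < z.re) : (evalC Z₁ z).re ≤ (evalC (Z₁ + Z₂) z).re := by
  rw [evalC_add (h1.1 z hz) (h2.1 z hz), Complex.add_re]
  linarith [h2.2 z hz]

/-- If a sum of positive-real functions has no poles on `jℝ ∪ ∞`, neither has the first
summand. -/
theorem IsPR.no_imag_poles_of_add {Z₁ Z₂ : RatFunc ℝ} (h1 : IsPR Z₁) (h2 : IsPR Z₂)
    (hsum : NoImagPolesZeros (Z₁ + Z₂)) :
    (∀ ω : ℝ, Z₁.denom.eval₂ (algebraMap ℝ ℂ) ((ω : ℂ) * Complex.I) ≠ 0) ∧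
      Z₁.num.natDegree ≤ Z₁.denom.natDegree := by
  obtain ⟨hdeg, hnum, hden⟩ := hsum
  refine ⟨fun ω => ?_, ?_⟩
  · have hcont := (continuousAt_evalC (hden ω)).tendsto
    have hlim := (Complex.continuous_re.tendsto _).comp hcont
    refine denom_ne_zero_of_re_bounded (M := (evalC (Z₁ + Z₂) (ω * Complex.I)).re + 1)
      (by simp) ?_
    filter_upwards [nhdsWithin_le_nhds (hlim.eventually (gt_mem_nhds (lt_add_one _))),
      self_mem_nhdsWithin] with z hz hpos
    exact ⟨h1.2 z hpos, (h1.re_le_re_add h2 hpos).trans (le_of_lt hz)⟩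
  · have hne : (Z₁ + Z₂).num ≠ 0 := by
      intro h
      exact hnum 0 (by simp [h])
    have hlim := div_tendsto_atTop_leadingCoeff_div_of_degree_eq (Z₁ + Z₂).num (Z₁ + Z₂).denom
      (by rw [degree_eq_natDegree hne, degree_eq_natDegree (RatFunc.denom_ne_zero _), hdeg])
    refine natDegree_num_le_of_bounded
      (M := (Z₁ + Z₂).num.leadingCoeff / (Z₁ + Z₂).denom.leadingCoeff + 1) ?_
    filter_upwards [hlim.eventually (gt_mem_nhds (lt_add_one _)), eventually_gt_atTop 0]
      with x hx hpos
    have hpos' : 0 < (x : ℂ).re := by simpa using hpos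
    refine ⟨h1.2 x hpos', (h1.re_le_re_add h2 hpos').trans ?_⟩
    rw [evalC_ofReal_re]
    exact le_of_lt hx

end

/-- if `Z₁` and `Z₂` are PR and `Z₁ + Z₂` is a minimum function
with minimum frequency `ω₀`, then neither `Z₁` nor `Z₂` has a pole on
`jℝ ∪ ∞`, and `Re (Z₁(jω₀)) = Re (Z₂(jω₀)) = 0`. -/
theorem stmt8 (Z₁ Z₂ : RatFunc ℝ) (ω₀ : ℝ)
    (h1 : IsPR Z₁) (h2 : IsPR Z₂) (hmin : IsMinFun (Z₁ + Z₂) ω₀) :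
    (∀ ω : ℝ, Z₁.denom.eval₂ (algebraMap ℝ ℂ) ((ω : ℂ) * Complex.I) ≠ 0) ∧
    Z₁.num.natDegree ≤ Z₁.denom.natDegree ∧
    (∀ ω : ℝ, Z₂.denom.eval₂ (algebraMap ℝ ℂ) ((ω : ℂ) * Complex.I) ≠ 0) ∧
    Z₂.num.natDegree ≤ Z₂.denom.natDegree ∧
    (evalC Z₁ ((ω₀ : ℂ) * Complex.I)).re = 0 ∧
    (evalC Z₂ ((ω₀ : ℂ) * Complex.I)).re = 0 := by
  obtain ⟨-, -, hsum, -, hzero⟩ := hmin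
  obtain ⟨hd1, hn1⟩ := h1.no_imag_poles_of_add h2 hsum
  obtain ⟨hd2, hn2⟩ := h2.no_imag_poles_of_add h1 (by rwa [add_comm])
  have hre1 := h1.re_nonneg_of_denom_ne_zero (by simp) (hd1 ω₀)
  have hre2 := h2.re_nonneg_of_denom_ne_zero (by simp) (hd2 ω₀)
  rw [evalC_add (hd1 ω₀) (hd2 ω₀), Complex.add_re] at hzero
  exact ⟨hd1, hn1, hd2, hn2, by linarith, by linarith⟩
end

section
/- Let H be a PR rational function, not identically zero, with no poles or zeros on jℝ ∪ ∞. Then for every real X > 0 there exists a real number μ > 0 such that H(μ) = μX. -/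
open Polynomial Matrix

/-- Evaluating a real polynomial at a real point of `ℂ` is the coercion of its real value. -/
theorem eval₂_algebraMap_ofReal (p : ℝ[X]) (x : ℝ) :
    p.eval₂ (algebraMap ℝ ℂ) (x : ℂ) = ((p.eval x : ℝ) : ℂ) :=
  eval₂_at_apply (algebraMap ℝ ℂ) x

theorem evalC_ofReal (H : RatFunc ℝ) (x : ℝ) : evalC H (x : ℂ) = (evalR H x : ℂ) := by
  simp only [evalC, evalR, eval₂_algebraMap_ofReal, Complex.ofReal_div]

theorem IsPR.evalR_nonneg {H : RatFunc ℝ} (hPR : IsPR H) {x : ℝ} (hx : 0 < x) :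
    0 ≤ evalR H x := by
  have h := hPR.2 (x : ℂ) (by simpa using hx)
  rwa [evalC_ofReal, Complex.ofReal_re] at h

theorem NoImagPolesZeros.eval_num_zero_ne {H : RatFunc ℝ} (h : NoImagPolesZeros H) :
    H.num.eval 0 ≠ 0 := fun h0 => h.2.1 0 <| by
  rw [Complex.ofReal_zero, zero_mul, ← Complex.ofReal_zero, eval₂_algebraMap_ofReal, h0]

theorem NoImagPolesZeros.eval_denom_zero_ne {H : RatFunc ℝ} (h : NoImagPolesZeros H) :
    H.denom.eval 0 ≠ 0 := fun h0 => h.2.2 0 <| by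
  rw [Complex.ofReal_zero, zero_mul, ← Complex.ofReal_zero, eval₂_algebraMap_ofReal, h0]

theorem IsPR.eval_denom_ne {H : RatFunc ℝ} (hPR : IsPR H) {x : ℝ} (hx : 0 < x) :
    H.denom.eval x ≠ 0 := fun h0 => hPR.1 (x : ℂ) (by simpa using hx) <| by
  rw [eval₂_algebraMap_ofReal, h0, Complex.ofReal_zero]

theorem IsPR.continuousOn_evalR {H : RatFunc ℝ} (hPR : IsPR H) (h : NoImagPolesZeros H) :
    ContinuousOn (evalR H) (Set.Ici 0) := by
  refine H.num.continuous.continuousOn.div H.denom.continuous.continuousOn fun x hx => ?_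
  rcases (Set.mem_Ici.1 hx).eq_or_lt with rfl | hx
  · exact h.eval_denom_zero_ne
  · exact hPR.eval_denom_ne hx

theorem IsPR.evalR_zero_pos {H : RatFunc ℝ} (hPR : IsPR H) (h : NoImagPolesZeros H) :
    0 < evalR H 0 := by
  have hne : evalR H 0 ≠ 0 := div_ne_zero h.eval_num_zero_ne h.eval_denom_zero_ne
  have hlim : Filter.Tendsto (evalR H) (nhdsWithin 0 (Set.Ioi 0)) (nhds (evalR H 0)) :=
    ((hPR.continuousOn_evalR h) 0 Set.self_mem_Ici).mono_left
      (nhdsWithin_mono 0 Set.Ioi_subset_Ici_self)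
  refine lt_of_le_of_ne (ge_of_tendsto hlim ?_) hne.symm
  filter_upwards [self_mem_nhdsWithin] with x hx using hPR.evalR_nonneg hx

theorem tendsto_evalR_atTop {H : RatFunc ℝ} (hne : H ≠ 0)
    (hdeg : H.num.natDegree = H.denom.natDegree) :
    Filter.Tendsto (evalR H) Filter.atTop
      (nhds (H.num.leadingCoeff / H.denom.leadingCoeff)) := by
  refine Polynomial.div_tendsto_atTop_leadingCoeff_div_of_degree_eq _ _ ?_
  rw [Polynomial.degree_eq_natDegree (RatFunc.num_ne_zero hne),
    Polynomial.degree_eq_natDegree H.denom_ne_zero, hdeg]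

/-- a PR function, not identically zero, with no poles or zeros on
`jℝ ∪ ∞` attains every slope: for each `X > 0` there is `μ > 0` with
`H(μ) = μX`. -/
theorem stmt9 (H : RatFunc ℝ) (hPR : IsPR H) (hne : H ≠ 0)
    (hnpz : NoImagPolesZeros H) :
    ∀ X : ℝ, 0 < X → ∃ μ : ℝ, 0 < μ ∧ evalR H μ = μ * X := by
  intro X hX
  obtain ⟨b, hb, hb0, hlt⟩ : ∃ b : ℝ, 0 < b ∧
      H.num.leadingCoeff / H.denom.leadingCoeff + 1 ≤ b * X ∧
      evalR H b < H.num.leadingCoeff / H.denom.leadingCoeff + 1 :=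
    ((Filter.eventually_gt_atTop 0).and
      (((Filter.tendsto_id.atTop_mul_const hX).eventually_ge_atTop _).and
        ((tendsto_evalR_atTop hne hnpz.1).eventually_lt_const (lt_add_one _)))).exists
  have hcont : ContinuousOn (fun x => evalR H x - x * X) (Set.Icc 0 b) :=
    ((hPR.continuousOn_evalR hnpz).mono Set.Icc_subset_Ici_self).sub (by fun_prop)
  obtain ⟨μ, hμ, h0⟩ := intermediate_value_Ioo' hb.le hcont
    (show (0 : ℝ) ∈ Set.Ioo (evalR H b - b * X) (evalR H 0 - 0 * X) from
      ⟨by linarith, by linarith [hPR.evalR_zero_pos hnpz]⟩)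
  exact ⟨μ, hμ.1, sub_eq_zero.1 h0⟩
end

section
/- Let K, ω₀, W, F be real numbers with K, ω₀ > 0, W > 0, W ≠ 1, F ≠ 0. Then, as an identity of rational functions obtained by substituting ω₀²/s for s, H_{K,ω₀,W,F}(ω₀²/s) = H_{KW², ω₀, 1/W, −F/W²}(s). -/
open Polynomial Matrix

theorem ratFunc_eval_algebraMap_div.{u} {K L : Type u} [Field K] [Field L] (f : K →+* L) (a : L)
    (p q : K[X]) (hq : q.eval₂ f a ≠ 0) :
    RatFunc.eval f a (algebraMap K[X] (RatFunc K) p / algebraMap K[X] (RatFunc K) q) =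
      p.eval₂ f a / q.eval₂ f a := by
  have hq0 : q ≠ 0 := by
    rintro rfl
    simp at hq
  obtain ⟨c, hc⟩ := RatFunc.denom_div_dvd p q
  set x := algebraMap K[X] (RatFunc K) p / algebraMap K[X] (RatFunc K) q with hx
  have hd : x.denom.eval₂ f a ≠ 0 := by
    intro h
    apply hq
    rw [hc, eval₂_mul, h, zero_mul]
  have h := congrArg (eval₂ f a) ((RatFunc.num_mul_eq_mul_denom_iff hq0).2 hx)
  rw [eval₂_mul, eval₂_mul] at h
  rw [RatFunc.eval, div_eq_div_iff hd hq, h]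

theorem ratFunc_quadratic_ne_zero {K : Type*} [Field K] (a b c : K) (hc : c ≠ 0) :
    RatFunc.C a * RatFunc.X ^ 2 + RatFunc.C b * RatFunc.X + RatFunc.C c ≠ 0 := by
  have h : algebraMap K[X] (RatFunc K) (C a * X ^ 2 + C b * X + C c) ≠ 0 := by
    apply RatFunc.algebraMap_ne_zero
    intro h
    simpa [hc] using congrArg (eval 0) h
  simpa using h

/-- frequency inversion of the biquadratic parametrisation:
`H_{K,ω₀,W,F}(ω₀²/s) = H_{KW²,ω₀,1/W,−F/W²}(s)`. -/
theorem stmt11 (K ω₀ W F : ℝ) (hK : 0 < K) (hω : 0 < ω₀)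
    (hW0 : 0 < W) (hW1 : W ≠ 1) (hF : F ≠ 0) :
    freqInv ω₀ (Hparam K ω₀ W F)
      = Hparam (K * W ^ 2) ω₀ (1 / W) (-F / W ^ 2) := by
  have hWne : W ≠ 0 := hW0.ne'
  have hωne : ω₀ ≠ 0 := hω.ne'
  have hX : (RatFunc.X : RatFunc ℝ) ≠ 0 := RatFunc.X_ne_zero
  have hWC : RatFunc.C W ≠ 0 := by simpa using hWne
  have hωC : RatFunc.C ω₀ ≠ 0 := by simpa using hωne
  have hFC : RatFunc.C F ≠ 0 := by simpa using hF
  have hH : Hparam K ω₀ W F =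
      algebraMap ℝ[X] (RatFunc ℝ)
          (C K * (X ^ 2 + C (ω₀ * (1 - W) * F / W) * X + C (ω₀ ^ 2 * W))) /
        algebraMap ℝ[X] (RatFunc ℝ)
          (X ^ 2 + C (ω₀ * (1 - W) / F) * X + C (ω₀ ^ 2 / W)) := by
    simp only [Hparam, map_add, map_mul, map_pow, RatFunc.algebraMap_C, RatFunc.algebraMap_X]
  have hden := ratFunc_quadratic_ne_zero (1 / W) (ω₀ * (1 - W) / F) (ω₀ ^ 2)
    (pow_ne_zero 2 hωne)
  have hden' := ratFunc_quadratic_ne_zero 1 (ω₀ * (1 - 1 / W) / (-F / W ^ 2))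
    (ω₀ ^ 2 / (1 / W)) (by positivity)
  have hq : (X ^ 2 + C (ω₀ * (1 - W) / F) * X + C (ω₀ ^ 2 / W)).eval₂
      (algebraMap ℝ (RatFunc ℝ)) (RatFunc.C (ω₀ ^ 2) / RatFunc.X) =
      RatFunc.C (ω₀ ^ 2) / RatFunc.X ^ 2 * (RatFunc.C (1 / W) * RatFunc.X ^ 2 +
        RatFunc.C (ω₀ * (1 - W) / F) * RatFunc.X + RatFunc.C (ω₀ ^ 2)) := by
    simp only [eval₂_add, eval₂_mul, eval₂_pow, eval₂_X, eval₂_C, RatFunc.algebraMap_eq_C,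
      map_div₀, map_mul, map_pow, map_sub, map_one]
    field_simp
    ring
  have hq0 : RatFunc.C (ω₀ ^ 2) / RatFunc.X ^ 2 * (RatFunc.C (1 / W) * RatFunc.X ^ 2 +
        RatFunc.C (ω₀ * (1 - W) / F) * RatFunc.X + RatFunc.C (ω₀ ^ 2)) ≠ 0 :=
    mul_ne_zero (div_ne_zero (by simpa using hωne) (pow_ne_zero 2 hX)) hden
  rw [freqInv, hH, ratFunc_eval_algebraMap_div _ _ _ _ (hq ▸ hq0), hq, Hparam]
  rw [map_one, one_mul] at hden'
  rw [div_eq_div_iff hq0 hden']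
  simp only [eval₂_add, eval₂_mul, eval₂_pow, eval₂_X, eval₂_C, RatFunc.algebraMap_eq_C,
    map_div₀, map_mul, map_pow, map_sub, map_one, map_neg]
  field_simp
  ring
end

section
/- Let K, ω₀ > 0, 0 < W < 1 and F > 0, and let H := H_{K,ω₀,W,F}. Set μ := Wω₀/F and α := (F² + W²)(1 − W)ω₀ / (2W²F). Then μ > 0, α > 0, H(μ) = KW, and, as an identity in ℝ(s), (μ·KW − s·H(s)) / (μ·H(s) − s·KW) = 1/W + 2αs/(s² + ω₀²). -/
open Polynomial Matrix

lemma evalR_div_algebraMap (p q : ℝ[X]) (x : ℝ) (hq : q.eval x ≠ 0) :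
    evalR (algebraMap ℝ[X] (RatFunc ℝ) p / algebraMap ℝ[X] (RatFunc ℝ) q) x =
      p.eval x / q.eval x := by
  have hq0 : q ≠ 0 := by
    rintro rfl
    simp at hq
  have hd := RatFunc.denom_div_dvd p q
  have hmul := (RatFunc.num_mul_eq_mul_denom_iff
    (x := algebraMap ℝ[X] (RatFunc ℝ) p / algebraMap ℝ[X] (RatFunc ℝ) q) (p := p) hq0).2 rfl
  have hd0 : (RatFunc.denom
      (algebraMap ℝ[X] (RatFunc ℝ) p / algebraMap ℝ[X] (RatFunc ℝ) q)).eval x ≠ 0 :=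
    fun h => hq (Polynomial.eval_eq_zero_of_dvd_of_eval_eq_zero hd h)
  rw [evalR, div_eq_div_iff hd0 hq]
  simpa using congrArg (Polynomial.eval x) hmul

lemma Hparam_eq_algebraMap_div (K ω₀ W F : ℝ) :
    Hparam K ω₀ W F =
      algebraMap ℝ[X] (RatFunc ℝ)
          (C K * (X ^ 2 + C (ω₀ * (1 - W) * F / W) * X + C (ω₀ ^ 2 * W))) /
        algebraMap ℝ[X] (RatFunc ℝ)
          (X ^ 2 + C (ω₀ * (1 - W) / F) * X + C (ω₀ ^ 2 / W)) := by
  simp only [Hparam, map_mul, map_add, map_pow, RatFunc.algebraMap_C, RatFunc.algebraMap_X]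

lemma algebraMap_ratFunc_ne_zero_of_eval_ne_zero (p : ℝ[X]) (x : ℝ) (h : p.eval x ≠ 0) :
    algebraMap ℝ[X] (RatFunc ℝ) p ≠ 0 := by
  refine RatFunc.algebraMap_ne_zero ?_
  rintro rfl
  simp at h

lemma biquadratic_transform {L : Type*} [Field L] {k w W F s : L}
    (hk : k ≠ 0) (hW : W ≠ 0) (hF : F ≠ 0) (h2 : (2 : L) ≠ 0)
    (hs : W * w / F - s ≠ 0) (hsw : s ^ 2 + w ^ 2 ≠ 0)
    (hD : s ^ 2 + w * (1 - W) / F * s + w ^ 2 / W ≠ 0) :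
    (W * w / F * (k * W) -
        s * (k * (s ^ 2 + w * (1 - W) * F / W * s + w ^ 2 * W) /
          (s ^ 2 + w * (1 - W) / F * s + w ^ 2 / W))) /
      (W * w / F * (k * (s ^ 2 + w * (1 - W) * F / W * s + w ^ 2 * W) /
          (s ^ 2 + w * (1 - W) / F * s + w ^ 2 / W)) - s * (k * W)) =
      1 / W + 2 * ((F ^ 2 + W ^ 2) * (1 - W) * w / (2 * W ^ 2 * F)) * s /
        (s ^ 2 + w ^ 2) := by
  set D := s ^ 2 + w * (1 - W) / F * s + w ^ 2 / W with hDdef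
  have hden : W * w / F * (k * (s ^ 2 + w * (1 - W) * F / W * s + w ^ 2 * W) / D) -
      s * (k * W) = k * (W * w / F - s) * (W * (s ^ 2 + w ^ 2)) / D := by
    rw [eq_div_iff hD, sub_mul, mul_assoc, div_mul_cancel₀ _ hD, hDdef]
    field_simp
    ring
  have hnum : W * w / F * (k * W) -
      s * (k * (s ^ 2 + w * (1 - W) * F / W * s + w ^ 2 * W) / D) =
      k * (W * w / F - s) *
        (s ^ 2 + (F ^ 2 + W ^ 2) * (1 - W) * w / (W * F) * s + w ^ 2) / D := by
    rw [eq_div_iff hD, sub_mul, mul_assoc s, div_mul_cancel₀ _ hD, hDdef]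
    field_simp
    ring
  rw [hnum, hden, div_div_div_cancel_right₀ hD, mul_div_mul_left _ _ (mul_ne_zero hk hs)]
  field_simp
  ring

/-- for `0 < W < 1`, `F > 0`, the biquadratic minimum function
`H := Hparam K ω₀ W F` satisfies, with `μ := Wω₀/F` and
`α := (F² + W²)(1−W)ω₀/(2W²F)`: `μ, α > 0`, `H(μ) = KW`, and
`(μKW − sH)/(μH − sKW) = 1/W + 2αs/(s² + ω₀²)`. -/
theorem stmt13 (K ω₀ W F : ℝ) (hK : 0 < K) (hω : 0 < ω₀)
    (hW0 : 0 < W) (hW1 : W < 1) (hF : 0 < F) :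
    0 < W * ω₀ / F ∧
    0 < (F ^ 2 + W ^ 2) * (1 - W) * ω₀ / (2 * W ^ 2 * F) ∧
    evalR (Hparam K ω₀ W F) (W * ω₀ / F) = K * W ∧
    (RatFunc.C (W * ω₀ / F * (K * W)) - RatFunc.X * Hparam K ω₀ W F) /
        (RatFunc.C (W * ω₀ / F) * Hparam K ω₀ W F -
          RatFunc.X * RatFunc.C (K * W)) =
      RatFunc.C (1 / W) +
        RatFunc.C (2 * ((F ^ 2 + W ^ 2) * (1 - W) * ω₀ / (2 * W ^ 2 * F))) *
          RatFunc.X / (RatFunc.X ^ 2 + RatFunc.C (ω₀ ^ 2)) := by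
  have hμ : 0 < W * ω₀ / F := by positivity
  have hW : 0 < 1 - W := sub_pos.2 hW1
  refine ⟨hμ, by positivity, ?_, ?_⟩
  · rw [Hparam_eq_algebraMap_div, evalR_div_algebraMap]
    · simp only [eval_mul, eval_add, eval_pow, eval_C, eval_X]
      rw [div_eq_iff (by positivity)]
      field_simp
      ring
    · simp only [eval_mul, eval_add, eval_pow, eval_C, eval_X]
      positivity
  · have hC : ∀ {a : ℝ}, a ≠ 0 → RatFunc.C a ≠ 0 := fun h => (_root_.map_ne_zero _).2 h
    have hs := algebraMap_ratFunc_ne_zero_of_eval_ne_zero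
      (C (W * ω₀ / F) - X) 0 (by simpa using hμ.ne')
    have hsw := algebraMap_ratFunc_ne_zero_of_eval_ne_zero
      (X ^ 2 + C (ω₀ ^ 2)) 0 (by simpa using hω.ne')
    have hD := algebraMap_ratFunc_ne_zero_of_eval_ne_zero
      (X ^ 2 + C (ω₀ * (1 - W) / F) * X + C (ω₀ ^ 2 / W)) 0
      (by simp [hω.ne', hW0.ne'])
    simp only [map_add, map_sub, map_mul, map_pow, RatFunc.algebraMap_C, RatFunc.algebraMap_X,
      map_div₀, map_one] at hs hsw hD
    have key := biquadratic_transform (hC hK.ne') (hC hW0.ne') (hC hF.ne') two_ne_zero hs hsw hD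
    simpa only [Hparam, map_add, map_sub, map_mul, map_pow, map_div₀, map_one, map_ofNat]
      using key
end
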